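/- Let H and H' be separable complex Hilbert spaces and let Φ : 𝔗(H) → 𝔗(H') be a positive linear trace-non-increasing map with dual map Φ* : 𝔅(H') → 𝔅(H). The following properties are equivalent: (i) the output entropy ρ ↦ H(Φ(ρ)) is finite at every state ρ ∈ 𝔖(H); (ii) the function ρ ↦ H(Φ(ρ)) is continuous and bounded on 𝔖(H); (iii) there exists an orthonormal basis {|i⟩}_{i=1}^{∞} of H' such that the function ρ ↦ H({⟨i|Φ(ρ)|i⟩}_{i=1}^{∞}) (classical entropy of the diagonal of Φ(ρ)) is continuous and bounded on 𝔖(H); (iv) there exist an orthonormal basis {|i⟩}_{i=1}^{∞} of H' and a sequence {h_i}_{i=1}^{∞} of nonnegative numbers such that the operator Σ_{i=1}^{∞} h_i Φ*(|i⟩⟨i|) is bounded and Σ_{i=1}^{∞} e^{−h_i} < +∞. -/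

import Mathlib

open scoped ENNReal NNReal
open Filter Topology Classical
attribute [local instance] Classical.propDecidable

noncomputable section

namespace QIT

section Defs

variable {E F G : Type*}
variable [NormedAddCommGroup E] [InnerProductSpace ℂ E] [CompleteSpace E]
variable [NormedAddCommGroup F] [InnerProductSpace ℂ F] [CompleteSpace F]
variable [NormedAddCommGroup G] [InnerProductSpace ℂ G] [CompleteSpace G]

/-- The real part of `⟪x, A x⟫`. -/
def qf (A : E →L[ℂ] E) (x : E) : ℝ := (inner ℂ x (A x) : ℂ).re

/-- The trace of a positive operator, as the supremum of finite diagonal sums over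
finite orthonormal families.  For positive operators this coincides with the usual
trace (with value `∞` when the operator is not trace class). -/
def traceENN (A : E →L[ℂ] E) : ℝ≥0∞ :=
  ⨆ (n : ℕ) (e : Fin n → E) (_ : Orthonormal ℂ e), ∑ i, ENNReal.ofReal (qf A (e i))

/-- The trace norm `‖A‖₁`, as the supremum of `∑ |⟪e i, A (f i)⟫|` over pairs of finite
orthonormal families; it is finite exactly on trace-class operators. -/
def traceNorm (A : E →L[ℂ] E) : ℝ≥0∞ :=
  ⨆ (n : ℕ) (e : Fin n → E) (f : Fin n → E) (_ : Orthonormal ℂ e) (_ : Orthonormal ℂ f),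
    ∑ i, ENNReal.ofReal ‖(inner ℂ (e i) (A (f i)) : ℂ)‖

/-- `A` is a trace-class operator. -/
def IsTC (A : E →L[ℂ] E) : Prop := traceNorm A ≠ ∞

/-- The cone `𝔗₊(E)` of positive trace-class operators. -/
def posTC (E : Type*) [NormedAddCommGroup E] [InnerProductSpace ℂ E] [CompleteSpace E] :
    Set (E →L[ℂ] E) := {A | A.IsPositive ∧ IsTC A}

/-- The set `𝔖(E)` of states (density operators). -/
def states (E : Type*) [NormedAddCommGroup E] [InnerProductSpace ℂ E] [CompleteSpace E] :
    Set (E →L[ℂ] E) := {A | A.IsPositive ∧ traceENN A = 1}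

/-- The extended classical entropy `H({x_i}) = ∑ η(x_i) − η(∑ x_i)` of a nonnegative
summable family, written in the equivalent homogeneous form `(∑ x) · H({x_i/∑x})`. -/
def clEntropy {ι : Type*} (x : ι → ℝ) : ℝ≥0∞ :=
  ENNReal.ofReal (∑' i, x i) *
    ∑' i, ENNReal.ofReal (Real.negMulLog (x i / (∑' j, x j)))

/-- An orthonormal subset with dense span (an orthonormal basis, as a set). -/
def IsONB (s : Set E) : Prop :=
  Orthonormal ℂ ((↑) : s → E) ∧ Dense ((Submodule.span ℂ s : Submodule ℂ E) : Set E)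

/-- The quantum (von Neumann) entropy `H(A) = Tr η(A) − η(Tr A)` of a positive trace-class
operator, realized as the infimum over all orthonormal bases of the classical entropy of
the diagonal of `A` (the infimum is attained on an eigenbasis of `A`). -/
def qEntropy (A : E →L[ℂ] E) : ℝ≥0∞ :=
  ⨅ (s : Set E) (_ : IsONB s), clEntropy fun v : s => qf A v

theorem exists_isONB (E : Type*) [NormedAddCommGroup E] [InnerProductSpace ℂ E]
    [CompleteSpace E] : ∃ s : Set E, IsONB s := by
  obtain ⟨w, b, hb⟩ := exists_hilbertBasis ℂ E
  refine ⟨w, ?_, ?_⟩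
  · have h := b.orthonormal
    rwa [hb] at h
  · have h := b.dense_span
    rw [hb, Subtype.range_coe] at h
    rwa [Submodule.dense_iff_topologicalClosure_eq_top]

/-- A fixed orthonormal basis (as a set). -/
def stdONB (E : Type*) [NormedAddCommGroup E] [InnerProductSpace ℂ E] [CompleteSpace E] :
    Set E := (exists_isONB E).choose

/-- The `ℂ`-valued trace, computed in a fixed orthonormal basis; for trace-class
operators it does not depend on the choice of the basis. -/
def traceC (A : E →L[ℂ] E) : ℂ := ∑' v : stdONB E, (inner ℂ (v : E) (A v) : ℂ)

/-- Continuity (including finiteness) of an `ℝ≥0∞`-valued function on a subset of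
operators, with respect to the trace-norm distance. -/
def ContOn (f : (E →L[ℂ] E) → ℝ≥0∞) (𝒜 : Set (E →L[ℂ] E)) : Prop :=
  (∀ A ∈ 𝒜, f A ≠ ∞) ∧
  ∀ A ∈ 𝒜, ∀ ε : ℝ, 0 < ε → ∃ δ : ℝ, 0 < δ ∧
    ∀ B ∈ 𝒜, traceNorm (B - A) < ENNReal.ofReal δ → |(f B).toReal - (f A).toReal| < ε

/-- Continuity of a real-valued function on a subset of operators with respect to the
trace-norm distance. -/
def RContOn (g : (E →L[ℂ] E) → ℝ) (𝒜 : Set (E →L[ℂ] E)) : Prop :=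
  ∀ A ∈ 𝒜, ∀ ε : ℝ, 0 < ε → ∃ δ : ℝ, 0 < δ ∧
    ∀ B ∈ 𝒜, traceNorm (B - A) < ENNReal.ofReal δ → |g B - g A| < ε

/-- Boundedness of an `ℝ≥0∞`-valued function on a set. -/
def BddOn (f : (E →L[ℂ] E) → ℝ≥0∞) (𝒜 : Set (E →L[ℂ] E)) : Prop :=
  ∃ C : ℝ, ∀ A ∈ 𝒜, f A ≤ ENNReal.ofReal C

/-- Convergence of a sequence of operators in the trace norm. -/
def TendstoTN (A : ℕ → (E →L[ℂ] E)) (A₀ : E →L[ℂ] E) : Prop :=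
  ∀ ε : ℝ, 0 < ε → ∃ N : ℕ, ∀ n ≥ N, traceNorm (A n - A₀) < ENNReal.ofReal ε

/-- A positive linear map from the trace class of `E` to the trace class of `F`
(the values of `toFun` outside the trace class are irrelevant). -/
structure TraceMap (E F : Type*) [NormedAddCommGroup E] [InnerProductSpace ℂ E]
    [CompleteSpace E] [NormedAddCommGroup F] [InnerProductSpace ℂ F] [CompleteSpace F] where
  toFun : (E →L[ℂ] E) → (F →L[ℂ] F)
  map_add : ∀ A B, IsTC A → IsTC B → toFun (A + B) = toFun A + toFun B
  map_smul : ∀ (c : ℂ) A, IsTC A → toFun (c • A) = c • toFun A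
  maps_tc : ∀ A, IsTC A → IsTC (toFun A)
  pos : ∀ A, IsTC A → A.IsPositive → (toFun A).IsPositive

/-- A trace-non-increasing map. -/
def TraceMap.TNI (Φ : TraceMap E F) : Prop :=
  ∀ A, IsTC A → A.IsPositive → traceENN (Φ.toFun A) ≤ traceENN A

/-- A trace-preserving map. -/
def TraceMap.TP (Φ : TraceMap E F) : Prop :=
  ∀ A, IsTC A → A.IsPositive → traceENN (Φ.toFun A) = traceENN A

/-- A map bounded with respect to the trace norm. -/
def TraceMap.Bounded (Φ : TraceMap E F) : Prop :=
  ∃ C : ℝ≥0, ∀ A, traceNorm (Φ.toFun A) ≤ (C : ℝ≥0∞) * traceNorm A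

/-- The output entropy `H_Φ = H ∘ Φ`. -/
def outEntropy (Φ : TraceMap E F) (A : E →L[ℂ] E) : ℝ≥0∞ := qEntropy (Φ.toFun A)

/-- The rank-one operator `|x⟩⟨x|`. -/
def rankOne (x : E) : E →L[ℂ] E := (innerSL ℂ x).smulRight x

/-- The rank-one operator `|x⟩⟨y|`. -/
def rankOneM (x y : E) : E →L[ℂ] E := (innerSL ℂ y).smulRight x

end Defs

section Defs2

variable {E F G : Type*}
variable [NormedAddCommGroup E] [InnerProductSpace ℂ E] [CompleteSpace E]
variable [NormedAddCommGroup F] [InnerProductSpace ℂ F] [CompleteSpace F]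
variable [NormedAddCommGroup G] [InnerProductSpace ℂ G] [CompleteSpace G]

/-- The completely positive map `A ↦ ∑ᵢ Vᵢ A Vᵢ*` defined by a sequence of Kraus
operators. -/
def krausMap (V : ℕ → (E →L[ℂ] F)) (A : E →L[ℂ] E) : F →L[ℂ] F :=
  ∑' i, V i ∘L A ∘L ContinuousLinearMap.adjoint (V i)

/-- The Kraus condition `∑ᵢ Vᵢ* Vᵢ ≤ I` (all partial sums are dominated by `I`). -/
def KrausTNI (V : ℕ → (E →L[ℂ] F)) : Prop :=
  ∀ n : ℕ,
    ((1 : E →L[ℂ] E) - ∑ i ∈ Finset.range n, ContinuousLinearMap.adjoint (V i) ∘L V i).IsPositive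

/-- The Kraus condition `∑ᵢ Vᵢ* Vᵢ = I` (strong convergence), i.e. trace preservation. -/
def KrausTP (V : ℕ → (E →L[ℂ] F)) : Prop :=
  ∀ x : E, HasSum (fun i => (ContinuousLinearMap.adjoint (V i)) (V i x)) x

/-- `(Φ, Φt)` is a complementary pair of quantum operations: for some Kraus
representation `Φ(·) = ∑ᵢ Vᵢ (·) Vᵢ*` and some orthonormal basis `{bᵢ}` of `G`,
`Φt(A) = ∑_{i,j} Tr[Vᵢ A Vⱼ*] |bᵢ⟩⟨bⱼ|` (characterized by its matrix entries). -/
def IsComplementaryPair (Φ : TraceMap E F) (Φt : TraceMap E G) : Prop :=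
  ∃ (V : ℕ → (E →L[ℂ] F)) (b : HilbertBasis ℕ ℂ G),
    KrausTNI V ∧
    (∀ A, IsTC A → Φ.toFun A = krausMap V A) ∧
    (∀ A, IsTC A → ∀ i j : ℕ,
      (inner ℂ (b i) (Φt.toFun A (b j)) : ℂ) =
        traceC (V i ∘L A ∘L ContinuousLinearMap.adjoint (V j)))

/-- A map (on trace-class operators) preserves continuity of the entropy:
its output entropy is continuous on every subset of the positive trace-class cone on
which the von Neumann entropy is continuous. -/
def PCE (Φf : (E →L[ℂ] E) → (F →L[ℂ] F)) : Prop :=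
  ∀ 𝒜 : Set (E →L[ℂ] E), 𝒜 ⊆ posTC E → ContOn qEntropy 𝒜 →
    ContOn (fun A => qEntropy (Φf A)) 𝒜

/-- `μ` is the sequence of nonzero eigenvalues (with multiplicities, possibly padded by
zeros) of the diagonalizable positive operator `T`, every vector orthogonal to the
eigenvectors being annihilated by `T`. -/
def IsEigenSeq (T : E →L[ℂ] E) (μ : ℕ → ℝ) : Prop :=
  ∃ e : ℕ → E,
    (∀ i j, i ≠ j → (inner ℂ (e i) (e j) : ℂ) = 0) ∧
    (∀ i, (μ i ≠ 0 → ‖e i‖ = 1) ∧ (μ i = 0 → e i = 0)) ∧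
    (∀ i, T (e i) = (μ i : ℂ) • e i) ∧
    (∀ x : E, (∀ i, (inner ℂ (e i) x : ℂ) = 0) → T x = 0)

/-- `ν` is the sequence of singular values of `V` (eigenvalues of `√(V*V)`,
equivalently `ν²` are the eigenvalues of `V*V`). -/
def IsSingularValues (V : E →L[ℂ] F) (ν : ℕ → ℝ) : Prop :=
  (∀ i, 0 ≤ ν i) ∧ IsEigenSeq (ContinuousLinearMap.adjoint V ∘L V) (fun i => ν i ^ 2)

/-- `∑ᵢ e^{−l/νᵢ²}`, the sum being taken over the indices with `νᵢ ≠ 0`. -/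
def expSum (ν : ℕ → ℝ) (l : ℝ) : ℝ≥0∞ :=
  ∑' i, if ν i = 0 then 0 else ENNReal.ofReal (Real.exp (-(l / ν i ^ 2)))

/-- `λ*(V) < ∞`: `V` is compact (automatic here) and `∑ᵢ e^{−l/νᵢ²} < ∞` for some
`l > 0`, where `{νᵢ}` are the singular values of `V`. -/
def LamStarFin (V : E →L[ℂ] F) : Prop :=
  ∃ ν : ℕ → ℝ, IsSingularValues V ν ∧ ∃ l : ℝ, 0 < l ∧ expSum ν l ≠ ∞

/-- `λ*(√S) < ∞` for a positive operator `S` (the singular values of `√S` are the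
square roots of the eigenvalues of `S`). -/
def LamStarSqrtFin (S : E →L[ℂ] E) : Prop :=
  ∃ ν : ℕ → ℝ, (∀ i, 0 ≤ ν i) ∧ IsEigenSeq S (fun i => ν i ^ 2) ∧
    ∃ l : ℝ, 0 < l ∧ expSum ν l ≠ ∞

/-- The value `λ*` associated to a sequence `ν` of singular values: the unique solution
of `∑ᵢ e^{−λ/νᵢ²} = 1` if it exists, and `inf{λ > 0 | ∑ᵢ e^{−λ/νᵢ²} < ∞}` otherwise. -/
def lamStarOf (ν : ℕ → ℝ) : ℝ≥0∞ :=
  if h : ∃ l : ℝ, expSum ν l = 1 then ENNReal.ofReal h.choose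
  else ⨅ (l : ℝ) (_ : 0 < l ∧ expSum ν l ≠ ∞), ENNReal.ofReal l

/-- The parameter `λ*(V) ∈ [0,∞]` of a bounded operator `V`. -/
def lamStar (V : E →L[ℂ] F) : ℝ≥0∞ :=
  if h : ∃ ν : ℕ → ℝ, IsSingularValues V ν then lamStarOf h.choose else ∞

/-- `rank A ≤ k`. -/
def rankLE (A : E →L[ℂ] E) (k : ℕ) : Prop :=
  Module.rank ℂ (LinearMap.range (A : E →ₗ[ℂ] E)) ≤ k

/-- The set `𝔗₊ᵏ(E)` of positive (trace-class) operators of rank at most `k`. -/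
def rankCone (E : Type*) [NormedAddCommGroup E] [InnerProductSpace ℂ E] [CompleteSpace E]
    (k : ℕ) : Set (E →L[ℂ] E) := {A | A.IsPositive ∧ rankLE A k}

/-- A decomposition of `A` into a countable convex combination of positive operators of
rank at most `k`. -/
structure Decomp (k : ℕ) (A : E →L[ℂ] E) where
  π : ℕ → ℝ
  op : ℕ → (E →L[ℂ] E)
  π_nonneg : ∀ i, 0 ≤ π i
  π_sum : HasSum π 1
  op_pos : ∀ i, (op i).IsPositive
  op_rank : ∀ i, rankLE (op i) k
  sum_eq : HasSum (fun i => π i • op i) A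

/-- The `k`-order approximator `H_Φᵏ` of the output entropy of `Φ`. -/
def kApprox (Φf : (E →L[ℂ] E) → (F →L[ℂ] F)) (k : ℕ) (A : E →L[ℂ] E) : ℝ≥0∞ :=
  ⨆ d : Decomp k A, ∑' i, ENNReal.ofReal (d.π i) * qEntropy (Φf (d.op i))

/-- The set of pure states (extreme points of `𝔖(E)`). -/
def pureStates (E : Type*) [NormedAddCommGroup E] [InnerProductSpace ℂ E]
    [CompleteSpace E] : Set (E →L[ℂ] E) := {A | ∃ x : E, ‖x‖ = 1 ∧ A = rankOne x}

end Defs2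

section Tensor

variable (E F G : Type*)
variable [NormedAddCommGroup E] [InnerProductSpace ℂ E] [CompleteSpace E]
variable [NormedAddCommGroup F] [InnerProductSpace ℂ F] [CompleteSpace F]
variable [NormedAddCommGroup G] [InnerProductSpace ℂ G] [CompleteSpace G]

/-- A realization of `G` as the Hilbert tensor product `E ⊗ F`, together with the
tensor product of (bounded) operators. -/
structure TensorData where
  tmul : E → F → G
  add_left : ∀ x y z, tmul (x + y) z = tmul x z + tmul y z
  add_right : ∀ x y z, tmul x (y + z) = tmul x y + tmul x z
  smul_left : ∀ (c : ℂ) x y, tmul (c • x) y = c • tmul x y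
  smul_right : ∀ (c : ℂ) x y, tmul x (c • y) = c • tmul x y
  inner_tmul : ∀ x x' y y',
    (inner ℂ (tmul x y) (tmul x' y') : ℂ) = (inner ℂ x x' : ℂ) * (inner ℂ y y' : ℂ)
  dense_span : Dense ((Submodule.span ℂ {z | ∃ x y, z = tmul x y} : Submodule ℂ G) : Set G)
  omul : (E →L[ℂ] E) → (F →L[ℂ] F) → (G →L[ℂ] G)
  omul_tmul : ∀ A B x y, omul A B (tmul x y) = tmul (A x) (B y)

end Tensor

set_option linter.unusedSectionVars false

/-! ### The function `x ↦ x - x log x` -/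

/-- The concave function `x - x log x`, increasing on `[0, 1]`. -/
def gfun (x : ℝ) : ℝ := x + Real.negMulLog x

theorem continuous_gfun : Continuous gfun := by unfold gfun; fun_prop

@[simp] theorem gfun_zero : gfun 0 = 0 := by simp [gfun]

theorem gfun_nonneg {x : ℝ} (h0 : 0 ≤ x) (h1 : x ≤ 1) : 0 ≤ gfun x :=
  add_nonneg h0 (Real.negMulLog_nonneg h0 h1)

/-- The function `gfun` lies below each of its tangent lines. -/
theorem gfun_le {x : ℝ} (h0 : 0 ≤ x) (h : ℝ) : gfun x ≤ h * x + Real.exp (-h) := by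
  rcases h0.eq_or_lt with rfl | hx
  · simpa using (Real.exp_pos _).le
  · have key := Real.add_one_le_exp (-h - Real.log x)
    rw [Real.exp_sub, Real.exp_log hx, le_div_iff₀ hx] at key
    simp only [gfun, Real.negMulLog]
    nlinarith

theorem gfun_eq {x : ℝ} (hx : 0 < x) :
    gfun x = -Real.log x * x + Real.exp (-(-Real.log x)) := by
  rw [neg_neg, Real.exp_log hx, gfun, Real.negMulLog]; ring

theorem gfun_mono {x y : ℝ} (h0 : 0 ≤ x) (hxy : x ≤ y) (h1 : y ≤ 1) : gfun x ≤ gfun y := by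
  rcases (h0.trans hxy).eq_or_lt with h | hy
  · rw [show x = y by linarith]
  · rw [gfun_eq hy]
    refine (gfun_le h0 (-Real.log y)).trans ?_
    have := Real.log_nonpos hy.le h1
    nlinarith

/-- Jensen's inequality for `gfun` with subnormalized weights. -/
theorem sum_mul_gfun_le {ι : Type*} (t : Finset ι) {c l : ι → ℝ} (hc : ∀ i ∈ t, 0 ≤ c i)
    (hl : ∀ i ∈ t, 0 ≤ l i) (hsum : ∑ i ∈ t, c i ≤ 1) :
    ∑ i ∈ t, c i * gfun (l i) ≤ gfun (∑ i ∈ t, c i * l i) := by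
  have hnn : ∀ i ∈ t, 0 ≤ c i * l i := fun i hi => mul_nonneg (hc i hi) (hl i hi)
  rcases (Finset.sum_nonneg hnn).eq_or_lt with h | h
  · rw [← h, gfun_zero]
    refine (Finset.sum_eq_zero fun i hi => ?_).le
    rcases mul_eq_zero.1 ((Finset.sum_eq_zero_iff_of_nonneg hnn).1 h.symm i hi) with h' | h' <;>
      simp [h']
  · rw [gfun_eq h]
    set k := -Real.log (∑ i ∈ t, c i * l i)
    calc ∑ i ∈ t, c i * gfun (l i) ≤ ∑ i ∈ t, c i * (k * l i + Real.exp (-k)) :=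
          Finset.sum_le_sum fun i hi => mul_le_mul_of_nonneg_left (gfun_le (hl i hi) k) (hc i hi)
      _ = k * ∑ i ∈ t, c i * l i + (∑ i ∈ t, c i) * Real.exp (-k) := by
          rw [Finset.mul_sum, Finset.sum_mul, ← Finset.sum_add_distrib]
          exact Finset.sum_congr rfl fun i _ => by ring
      _ ≤ _ := by nlinarith [Real.exp_pos (-k)]

theorem mul_gfun_le {p x : ℝ} (hp : 0 ≤ p) (hp1 : p ≤ 1) (hx : 0 ≤ x) :
    p * gfun x ≤ gfun (p * x) := by
  simpa using sum_mul_gfun_le (Finset.univ : Finset Unit) (c := fun _ => p) (l := fun _ => x)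
    (by simpa) (by simpa) (by simpa)

/-- The classical entropy in terms of `gfun`. -/
theorem clEntropy_add_gfun {ι : Type*} {x : ι → ℝ} (hx : ∀ i, 0 ≤ x i) (hs : Summable x)
    (h1 : ∑' i, x i ≤ 1) :
    clEntropy x + ENNReal.ofReal (gfun (∑' i, x i)) = ∑' i, ENNReal.ofReal (gfun (x i)) := by
  unfold clEntropy
  set T := ∑' i, x i with hT
  have hxT : ∀ i, x i ≤ T := fun i => hs.le_tsum i fun j _ => hx j
  have hT0 : 0 ≤ T := tsum_nonneg hx
  rcases hT0.eq_or_lt with h | h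
  · have : ∀ i, x i = 0 := fun i => le_antisymm (by rw [h]; exact hxT i) (hx i)
    simp [← h, this]
  have hlog : 0 ≤ 1 - Real.log T := by linarith [Real.log_nonpos hT0 h1]
  have hg : gfun T = ∑' i, x i * (1 - Real.log T) := by
    rw [tsum_mul_right, ← hT, gfun, Real.negMulLog]; ring
  rw [hg, ENNReal.ofReal_tsum_of_nonneg (fun i => mul_nonneg (hx i) hlog) (hs.mul_right _),
    ← ENNReal.tsum_mul_left, ← ENNReal.tsum_add]
  refine tsum_congr fun i => ?_
  rw [← ENNReal.ofReal_mul hT0, ← ENNReal.ofReal_add _ (mul_nonneg (hx i) hlog)]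
  · congr 1
    rcases (hx i).eq_or_lt with h0 | h0
    · simp [← h0]
    · rw [gfun, Real.negMulLog, Real.negMulLog, Real.log_div h0.ne' h.ne']
      field_simp
      ring
  · exact mul_nonneg hT0 (Real.negMulLog_nonneg (div_nonneg (hx i) hT0)
      (div_le_one_of_le₀ (hxT i) hT0))

/-! ### Positive operators of finite trace -/

section Trace

variable {E F : Type*}
variable [NormedAddCommGroup E] [InnerProductSpace ℂ E] [CompleteSpace E]
variable [NormedAddCommGroup F] [InnerProductSpace ℂ F] [CompleteSpace F]

theorem IsONB.exists_hilbertBasis {s : Set E} (hs : IsONB s) :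
    ∃ b : HilbertBasis s ℂ E, ⇑b = ((↑) : s → E) := by
  refine ⟨HilbertBasis.mk hs.1 ?_, HilbertBasis.coe_mk _ _⟩
  rw [Subtype.range_coe, (Submodule.dense_iff_topologicalClosure_eq_top).1 hs.2]

theorem isONB_of_hilbertBasis {s : Set E} (b : HilbertBasis s ℂ E)
    (hb : ⇑b = ((↑) : s → E)) : IsONB s := by
  refine ⟨hb ▸ b.orthonormal, ?_⟩
  have h := b.dense_span
  rw [hb, Subtype.range_coe] at h
  rwa [Submodule.dense_iff_topologicalClosure_eq_top]

theorem IsONB.hasSum_norm_inner_sq {s : Set E} (hs : IsONB s) (x : E) :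
    HasSum (fun v : s => ‖(inner ℂ (v : E) x : ℂ)‖ ^ 2) (‖x‖ ^ 2) := by
  obtain ⟨b, hb⟩ := hs.exists_hilbertBasis
  have h := b.hasSum_inner_mul_inner x x
  rw [hb] at h
  have h2 := Complex.hasSum_re h
  convert h2 using 1
  · funext v
    rw [← inner_conj_symm x, ← Complex.normSq_eq_conj_mul_self, Complex.ofReal_re,
      Complex.normSq_eq_norm_sq]
  · rw [inner_self_eq_norm_sq_to_K]; norm_cast

/-- Parseval's identity. -/
theorem IsONB.tsum_ofReal_norm_inner_sq {s : Set E} (hs : IsONB s) (x : E) :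
    ∑' v : s, ENNReal.ofReal (‖(inner ℂ (v : E) x : ℂ)‖ ^ 2) = ENNReal.ofReal (‖x‖ ^ 2) := by
  have h := hs.hasSum_norm_inner_sq x
  rw [← h.tsum_eq, ENNReal.ofReal_tsum_of_nonneg (fun _ => by positivity) h.summable]

theorem exists_sqrt {A : E →L[ℂ] E} (hA : A.IsPositive) :
    ∃ B : E →L[ℂ] E, (∀ x y, (inner ℂ (B x) y : ℂ) = inner ℂ x (B y)) ∧
      (∀ x, A x = B (B x)) ∧ ∀ x, qf A x = ‖B x‖ ^ 2 := by
  have hA' : (0 : E →L[ℂ] E) ≤ A := (ContinuousLinearMap.nonneg_iff_isPositive A).2 hA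
  have hB : (CFC.sqrt A).IsPositive :=
    (ContinuousLinearMap.nonneg_iff_isPositive _).1 (CFC.sqrt_nonneg A)
  have hBB : ∀ x, A x = CFC.sqrt A (CFC.sqrt A x) := fun x => by
    conv_lhs => rw [← CFC.sqrt_mul_sqrt_self A hA']
    rfl
  refine ⟨CFC.sqrt A, hB.inner_left_eq_inner_right, hBB, fun x => ?_⟩
  rw [qf, hBB, ← hB.inner_left_eq_inner_right, inner_self_eq_norm_sq_to_K]
  norm_cast

theorem qf_nonneg {A : E →L[ℂ] E} (hA : A.IsPositive) (x : E) : 0 ≤ qf A x :=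
  hA.re_inner_nonneg_right x

theorem qf_add (A B : E →L[ℂ] E) (x : E) : qf (A + B) x = qf A x + qf B x := by
  simp [qf]

theorem qf_smul (r : ℝ) (A : E →L[ℂ] E) (x : E) : qf ((r : ℂ) • A) x = r * qf A x := by
  simp [qf]

/-- A finite family satisfying Bessel's inequality. -/
def BesselFam {ι : Type*} (t : Finset ι) (z : ι → E) : Prop :=
  ∀ y : E, ∑ i ∈ t, ‖(inner ℂ (z i) y : ℂ)‖ ^ 2 ≤ ‖y‖ ^ 2

theorem _root_.Orthonormal.besselFam {ι : Type*} {z : ι → E} (hz : Orthonormal ℂ z)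
    (t : Finset ι) : BesselFam t z := fun _ => hz.sum_inner_products_le _

theorem BesselFam.sum_qf_le_tsum {ι : Type*} {t : Finset ι} {z : ι → E} (hz : BesselFam t z)
    {A : E →L[ℂ] E} (hA : A.IsPositive) {s : Set E} (hs : IsONB s) :
    ∑ i ∈ t, ENNReal.ofReal (qf A (z i)) ≤ ∑' v : s, ENNReal.ofReal (qf A v) := by
  obtain ⟨B, hB, -, hq⟩ := exists_sqrt hA
  simp only [hq]
  calc ∑ i ∈ t, ENNReal.ofReal (‖B (z i)‖ ^ 2)
      = ∑ i ∈ t, ∑' v : s, ENNReal.ofReal (‖(inner ℂ (z i) (B v) : ℂ)‖ ^ 2) := by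
        refine Finset.sum_congr rfl fun i _ => ?_
        rw [← hs.tsum_ofReal_norm_inner_sq]
        refine tsum_congr fun v => ?_
        rw [← hB, norm_inner_symm]
    _ = ∑' v : s, ∑ i ∈ t, ENNReal.ofReal (‖(inner ℂ (z i) (B v) : ℂ)‖ ^ 2) :=
        (Summable.tsum_finsetSum fun _ _ => ENNReal.summable).symm
    _ ≤ _ := by
        refine ENNReal.tsum_le_tsum fun v => ?_
        rw [← ENNReal.ofReal_sum_of_nonneg fun _ _ => by positivity]
        exact ENNReal.ofReal_le_ofReal (hz _)

theorem IsONB.traceENN_eq {A : E →L[ℂ] E} (hA : A.IsPositive) {s : Set E} (hs : IsONB s) :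
    traceENN A = ∑' v : s, ENNReal.ofReal (qf A v) := by
  refine le_antisymm ?_ ?_
  · refine iSup_le fun n => iSup_le fun e => iSup_le fun he => ?_
    exact (he.besselFam Finset.univ).sum_qf_le_tsum hA hs
  · refine ENNReal.summable.tsum_le_of_sum_le fun t => ?_
    let e := t.equivFin.symm
    have he : Orthonormal ℂ fun i => ((e i : s) : E) :=
      hs.1.comp (fun i => (e i : s)) (Subtype.val_injective.comp e.injective)
    refine le_trans (le_of_eq ?_) (le_iSup_of_le t.card (le_iSup_of_le _ (le_iSup_of_le he le_rfl)))
    rw [← Finset.sum_coe_sort t]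
    exact (Equiv.sum_comp e fun v : t => ENNReal.ofReal (qf A (v : s))).symm

theorem BesselFam.sum_qf_le_traceENN {ι : Type*} {t : Finset ι} {z : ι → E}
    (hz : BesselFam t z) {A : E →L[ℂ] E} (hA : A.IsPositive) :
    ∑ i ∈ t, ENNReal.ofReal (qf A (z i)) ≤ traceENN A := by
  obtain ⟨s, hs⟩ := exists_isONB E
  rw [hs.traceENN_eq hA]
  exact hz.sum_qf_le_tsum hA hs

/-- Positive operators of finite trace. -/
def PosTr (A : E →L[ℂ] E) : Prop := A.IsPositive ∧ traceENN A ≠ ∞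

/-- The real-valued trace of a positive operator. -/
def trR (A : E →L[ℂ] E) : ℝ := (traceENN A).toReal

theorem trR_nonneg (A : E →L[ℂ] E) : 0 ≤ trR A := ENNReal.toReal_nonneg

theorem PosTr.ofReal_trR {A : E →L[ℂ] E} (hA : PosTr A) : ENNReal.ofReal (trR A) = traceENN A :=
  ENNReal.ofReal_toReal hA.2

theorem BesselFam.sum_qf_le {ι : Type*} {t : Finset ι} {z : ι → E} (hz : BesselFam t z)
    {A : E →L[ℂ] E} (hA : PosTr A) : ∑ i ∈ t, qf A (z i) ≤ trR A := by
  rw [← ENNReal.ofReal_le_ofReal_iff (trR_nonneg A), hA.ofReal_trR,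
    ENNReal.ofReal_sum_of_nonneg fun _ _ => qf_nonneg hA.1 _]
  exact hz.sum_qf_le_traceENN hA.1

theorem PosTr.hasSum {A : E →L[ℂ] E} (hA : PosTr A) {s : Set E} (hs : IsONB s) :
    HasSum (fun v : s => qf A v) (trR A) := by
  have h := hs.traceENN_eq hA.1
  have hfin := hA.2
  rw [h] at hfin
  have h2 := ENNReal.hasSum_toReal hfin
  simp only [ENNReal.toReal_ofReal (qf_nonneg hA.1 _)] at h2
  convert h2
  rw [trR, h, ENNReal.tsum_toReal_eq fun v => ENNReal.ofReal_ne_top]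
  simp only [ENNReal.toReal_ofReal (qf_nonneg hA.1 _)]

theorem PosTr.qf_le {A : E →L[ℂ] E} (hA : PosTr A) {x : E} (hx : ‖x‖ ≤ 1) : qf A x ≤ trR A := by
  have hz : BesselFam (Finset.univ : Finset Unit) (fun _ => x) := fun y => by
    simp only [Finset.univ_unique, Finset.sum_const, Finset.card_singleton, one_smul]
    refine pow_le_pow_left₀ (norm_nonneg _) ((norm_inner_le_norm _ _).trans ?_) 2
    exact mul_le_of_le_one_left (norm_nonneg _) hx
  simpa using hz.sum_qf_le hA

theorem traceENN_add {A B : E →L[ℂ] E} (hA : A.IsPositive) (hB : B.IsPositive) :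
    traceENN (A + B) = traceENN A + traceENN B := by
  obtain ⟨s, hs⟩ := exists_isONB E
  rw [hs.traceENN_eq hA, hs.traceENN_eq hB, hs.traceENN_eq (hA.add hB), ← ENNReal.tsum_add]
  refine tsum_congr fun v => ?_
  rw [qf_add, ENNReal.ofReal_add (qf_nonneg hA _) (qf_nonneg hB _)]

theorem isPositive_smul {A : E →L[ℂ] E} (hA : A.IsPositive) {r : ℝ} (hr : 0 ≤ r) :
    ((r : ℂ) • A).IsPositive := hA.smul_of_nonneg (by simpa using hr)

theorem traceENN_smul {A : E →L[ℂ] E} (hA : A.IsPositive) {r : ℝ} (hr : 0 ≤ r) :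
    traceENN ((r : ℂ) • A) = ENNReal.ofReal r * traceENN A := by
  obtain ⟨s, hs⟩ := exists_isONB E
  rw [hs.traceENN_eq hA, hs.traceENN_eq (isPositive_smul hA hr), ← ENNReal.tsum_mul_left]
  refine tsum_congr fun v => ?_
  rw [qf_smul, ENNReal.ofReal_mul hr]

theorem PosTr.add {A B : E →L[ℂ] E} (hA : PosTr A) (hB : PosTr B) : PosTr (A + B) :=
  ⟨hA.1.add hB.1, by rw [traceENN_add hA.1 hB.1]; exact ENNReal.add_ne_top.2 ⟨hA.2, hB.2⟩⟩

theorem PosTr.trR_add {A B : E →L[ℂ] E} (hA : PosTr A) (hB : PosTr B) :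
    trR (A + B) = trR A + trR B := by
  rw [trR, traceENN_add hA.1 hB.1, ENNReal.toReal_add hA.2 hB.2]; rfl

theorem PosTr.smul {A : E →L[ℂ] E} (hA : PosTr A) {r : ℝ} (hr : 0 ≤ r) : PosTr ((r : ℂ) • A) :=
  ⟨isPositive_smul hA.1 hr, by
    rw [traceENN_smul hA.1 hr]; exact ENNReal.mul_ne_top ENNReal.ofReal_ne_top hA.2⟩

theorem PosTr.trR_smul {A : E →L[ℂ] E} (hA : PosTr A) {r : ℝ} (hr : 0 ≤ r) :
    trR ((r : ℂ) • A) = r * trR A := by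
  rw [trR, traceENN_smul hA.1 hr, ENNReal.toReal_mul, ENNReal.toReal_ofReal hr]; rfl

theorem posTr_zero : PosTr (0 : E →L[ℂ] E) := by
  refine ⟨ContinuousLinearMap.isPositive_zero, ?_⟩
  obtain ⟨s, hs⟩ := exists_isONB E
  rw [hs.traceENN_eq ContinuousLinearMap.isPositive_zero]
  simp [qf]

theorem traceNorm_le_traceENN {A : E →L[ℂ] E} (hA : A.IsPositive) :
    traceNorm A ≤ traceENN A := by
  obtain ⟨B, hB, hBB, hq⟩ := exists_sqrt hA
  refine iSup_le fun n => iSup_le fun e => iSup_le fun f => iSup_le fun he => iSup_le fun hf => ?_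
  have h1 := (he.besselFam Finset.univ).sum_qf_le_traceENN hA
  have h2 := (hf.besselFam Finset.univ).sum_qf_le_traceENN hA
  have h3 : 2 * ∑ i, ENNReal.ofReal ‖(inner ℂ (e i) (A (f i)) : ℂ)‖ ≤ 2 * traceENN A := by
    rw [two_mul (traceENN A)]
    refine le_trans ?_ (add_le_add h1 h2)
    rw [Finset.mul_sum, ← Finset.sum_add_distrib]
    refine Finset.sum_le_sum fun i _ => ?_
    rw [← ENNReal.ofReal_add (qf_nonneg hA _) (qf_nonneg hA _), hq, hq, hBB, ← hB,
      show (2 : ℝ≥0∞) = ENNReal.ofReal 2 by simp, ← ENNReal.ofReal_mul zero_le_two]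
    refine ENNReal.ofReal_le_ofReal ?_
    have := norm_inner_le_norm (𝕜 := ℂ) (B (e i)) (B (f i))
    nlinarith [sq_nonneg (‖B (e i)‖ - ‖B (f i)‖)]
  exact (ENNReal.mul_le_mul_iff_right two_ne_zero ENNReal.ofNat_ne_top).1 h3

theorem PosTr.isTC {A : E →L[ℂ] E} (hA : PosTr A) : IsTC A :=
  ne_top_of_le_ne_top hA.2 (traceNorm_le_traceENN hA.1)

theorem posTr_of_mem_states {A : E →L[ℂ] E} (hA : A ∈ states E) : PosTr A :=
  ⟨hA.1, by rw [hA.2]; simp⟩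

theorem trR_of_mem_states {A : E →L[ℂ] E} (hA : A ∈ states E) : trR A = 1 := by
  simp [trR, hA.2]

theorem PosTr.mem_states {A : E →L[ℂ] E} (hA : PosTr A) (h : trR A = 1) : A ∈ states E :=
  ⟨hA.1, by rw [← hA.ofReal_trR, h]; simp⟩

theorem rankOne_apply (x y : E) : rankOne x y = (inner ℂ x y : ℂ) • x := rfl

theorem qf_rankOne (x y : E) : qf (rankOne x) y = ‖(inner ℂ y x : ℂ)‖ ^ 2 := by
  rw [qf, rankOne_apply, inner_smul_right, ← inner_conj_symm, ← Complex.normSq_eq_conj_mul_self,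
    Complex.ofReal_re, Complex.normSq_eq_norm_sq]

theorem isPositive_rankOne (x : E) : (rankOne x).IsPositive := by
  rw [ContinuousLinearMap.isPositive_iff_complex]
  intro y
  have : (inner ℂ (rankOne x y) y : ℂ) = ((‖(inner ℂ x y : ℂ)‖ ^ 2 : ℝ) : ℂ) := by
    rw [rankOne_apply, inner_smul_left, ← Complex.normSq_eq_conj_mul_self,
      Complex.normSq_eq_norm_sq]
  rw [this]
  exact ⟨by rw [RCLike.re_to_complex, Complex.ofReal_re],
    by rw [RCLike.re_to_complex, Complex.ofReal_re]; positivity⟩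

theorem traceENN_rankOne (x : E) : traceENN (rankOne x) = ENNReal.ofReal (‖x‖ ^ 2) := by
  obtain ⟨s, hs⟩ := exists_isONB E
  rw [hs.traceENN_eq (isPositive_rankOne x), ← hs.tsum_ofReal_norm_inner_sq]
  simp only [qf_rankOne]

theorem posTr_rankOne (x : E) : PosTr (rankOne x) :=
  ⟨isPositive_rankOne x, by rw [traceENN_rankOne]; exact ENNReal.ofReal_ne_top⟩

theorem trR_rankOne (x : E) : trR (rankOne x) = ‖x‖ ^ 2 := by
  rw [trR, traceENN_rankOne, ENNReal.toReal_ofReal (by positivity)]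

end Trace

/-! ### Additive functionals on positive operators of finite trace -/

section Additive

variable {E F : Type*}
variable [NormedAddCommGroup E] [InnerProductSpace ℂ E] [CompleteSpace E]
variable [NormedAddCommGroup F] [InnerProductSpace ℂ F] [CompleteSpace F]

/-- Additivity on the cone of positive operators of finite trace. -/
def PosAdditive {M : Type*} [Add M] (L : (E →L[ℂ] E) → M) : Prop :=
  ∀ A B, PosTr A → PosTr B → L (A + B) = L A + L B

theorem posAdditive_trR : PosAdditive (trR : (E →L[ℂ] E) → ℝ) := fun _ _ hA hB => hA.trR_add hB

theorem posTr_sum {ι : Type*} (t : Finset ι) {f : ι → E →L[ℂ] E} (hf : ∀ i ∈ t, PosTr (f i)) :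
    PosTr (∑ i ∈ t, f i) :=
  Finset.sum_induction f PosTr (fun _ _ hA hB => hA.add hB) posTr_zero hf

theorem PosAdditive.map_sum {M : Type*} [AddCommGroup M] {L : (E →L[ℂ] E) → M}
    (hL : PosAdditive L) {ι : Type*} (t : Finset ι) {f : ι → E →L[ℂ] E}
    (hf : ∀ i ∈ t, PosTr (f i)) : L (∑ i ∈ t, f i) = ∑ i ∈ t, L (f i) := by
  induction t using Finset.induction_on with
  | empty =>
    have := hL 0 0 posTr_zero posTr_zero
    simpa using this
  | insert a t ha ih =>
    have ht : ∀ i ∈ t, PosTr (f i) := fun i hi => hf i (Finset.mem_insert_of_mem hi)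
    rw [Finset.sum_insert ha, Finset.sum_insert ha,
      hL _ _ (hf a (Finset.mem_insert_self a t)) (posTr_sum t ht), ih ht]

theorem PosTr.map {Φ : TraceMap E F} (hΦ : Φ.TNI) {A : E →L[ℂ] E} (hA : PosTr A) :
    PosTr (Φ.toFun A) :=
  ⟨Φ.pos A hA.isTC hA.1, ne_top_of_le_ne_top hA.2 (hΦ A hA.isTC hA.1)⟩

theorem PosTr.trR_map_le {Φ : TraceMap E F} (hΦ : Φ.TNI) {A : E →L[ℂ] E} (hA : PosTr A) :
    trR (Φ.toFun A) ≤ trR A :=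
  ENNReal.toReal_mono hA.2 (hΦ A hA.isTC hA.1)

theorem TraceMap.posAdditive (Φ : TraceMap E F) : PosAdditive Φ.toFun :=
  fun A B hA hB => Φ.map_add A B hA.isTC hB.isTC

theorem TraceMap.posAdditive_qf (Φ : TraceMap E F) (v : F) :
    PosAdditive fun A => qf (Φ.toFun A) v := fun A B hA hB => by
  change qf (Φ.toFun (A + B)) v = _
  rw [Φ.posAdditive A B hA hB, qf_add]

theorem TraceMap.posAdditive_trR {Φ : TraceMap E F} (hΦ : Φ.TNI) :
    PosAdditive fun A => trR (Φ.toFun A) := fun A B hA hB => by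
  change trR (Φ.toFun (A + B)) = _
  rw [Φ.posAdditive A B hA hB, (hA.map hΦ).trR_add (hB.map hΦ)]

/-- An additive functional dominated by a multiple of the trace is controlled by its values
on rank-one operators. -/
theorem PosAdditive.le_of_rankOne {L : (E →L[ℂ] E) → ℝ} (hL : PosAdditive L) {K C : ℝ}
    (hK : ∀ A, PosTr A → L A ≤ K * trR A) (hC : ∀ x, L (rankOne x) ≤ C * ‖x‖ ^ 2)
    {A : E →L[ℂ] E} (hA : PosTr A) : L A ≤ C * trR A := by
  obtain ⟨B, hB, -, hq⟩ := exists_sqrt hA.1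
  obtain ⟨s, hs⟩ := exists_isONB E
  have key : ∀ t : Finset s, L A ≤
      C * ∑ b ∈ t, qf A b + K * (trR A - ∑ b ∈ t, qf A b) := by
    intro t
    set S := ∑ b ∈ t, rankOne (B b) with hS
    have hSP : PosTr S := posTr_sum t fun b _ => posTr_rankOne _
    have hqS : ∀ x, qf S x = ∑ b ∈ t, ‖(inner ℂ (b : E) (B x) : ℂ)‖ ^ 2 := by
      intro x
      have : qf S x = ∑ b ∈ t, qf (rankOne (B b)) x := by
        simp [hS, qf]
      rw [this]
      refine Finset.sum_congr rfl fun b _ => ?_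
      rw [qf_rankOne, ← hB, norm_inner_symm]
    have hRpos : (A - S).IsPositive := by
      rw [ContinuousLinearMap.isPositive_iff]
      refine ⟨hA.1.isSelfAdjoint.sub hSP.1.isSelfAdjoint |>.isSymmetric, fun x => ?_⟩
      have h1 : RCLike.re (inner ℂ ((A - S) x) x : ℂ) = qf A x - qf S x := by
        rw [inner_re_symm]
        simp [qf, inner_sub_right]
      have h2 : 0 ≤ qf A x - qf S x := by
        rw [hqS, hq, sub_nonneg]
        exact (hs.1.besselFam t) (B x)
      rw [← h1] at h2
      have h3 := (hA.1.isSelfAdjoint.sub hSP.1.isSelfAdjoint).isSymmetric.coe_re_inner_apply_self x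
      rw [RCLike.nonneg_iff]
      refine ⟨h2, ?_⟩
      have h4 := congrArg RCLike.im h3
      rw [RCLike.ofReal_im] at h4
      exact h4.symm
    have hR : PosTr (A - S) := ⟨hRpos, by
      have := traceENN_add hRpos hSP.1
      rw [sub_add_cancel] at this
      exact ne_top_of_le_ne_top hA.2 (this ▸ le_self_add)⟩
    have e : A = S + (A - S) := by abel
    have htrS : trR S = ∑ b ∈ t, qf A b := by
      rw [posAdditive_trR.map_sum t fun b _ => posTr_rankOne _]
      exact Finset.sum_congr rfl fun b _ => by rw [trR_rankOne, hq]
    have htr := hSP.trR_add hR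
    rw [← e, htrS] at htr
    have hLA := hL S _ hSP hR
    rw [← e] at hLA
    rw [hLA, show trR A - ∑ b ∈ t, qf A b = trR (A - S) by linarith]
    refine add_le_add ?_ (hK _ hR)
    rw [hL.map_sum t fun b _ => posTr_rankOne _, Finset.mul_sum]
    exact Finset.sum_le_sum fun b _ => by rw [hq]; exact hC _
  have hsum : Tendsto (fun t : Finset s => ∑ b ∈ t, qf A b) atTop (𝓝 (trR A)) := hA.hasSum hs
  have hlim := (hsum.const_mul C).add ((hsum.const_sub (trR A)).const_mul K)
  rw [sub_self, mul_zero, add_zero] at hlim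
  exact ge_of_tendsto' hlim key

theorem traceENN_le_traceNorm {P N D : E →L[ℂ] E} (hP : P.IsPositive)
    (hNP : ∀ x, N (P x) = 0)
    (hD : ∀ v, ‖(inner ℂ v (D v) : ℂ)‖ = ‖(inner ℂ v (P v) : ℂ) - inner ℂ v (N v)‖) :
    traceENN P ≤ traceNorm D := by
  let K : Submodule ℂ E := (LinearMap.range (P : E →ₗ[ℂ] E)).topologicalClosure
  have : CompleteSpace K := (Submodule.isClosed_topologicalClosure _).completeSpace_coe
  obtain ⟨w, b, hb⟩ := exists_hilbertBasis ℂ K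
  have hw : Orthonormal ℂ ((↑) : (Subtype.val '' w : Set E) → E) := by
    have h1 : Orthonormal ℂ ((↑) : w → K) := hb ▸ b.orthonormal
    have h2 : Orthonormal ℂ (fun i : w => ((i : K) : E)) :=
      h1.comp_linearIsometry K.subtypeₗᵢ
    have h3 := h2.toSubtypeRange
    convert h3 using 2 <;> ext <;> simp
  obtain ⟨s, c, hsub, hc⟩ := hw.exists_hilbertBasis_extension
  have hs := isONB_of_hilbertBasis c hc
  have hNK : ∀ v ∈ K, N v = 0 := by
    intro v hv
    have hcl : IsClosed {v | N v = 0} := isClosed_eq N.continuous continuous_const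
    refine closure_minimal ?_ hcl hv
    rintro _ ⟨x, rfl⟩
    exact hNP x
  have hterm : ∀ v : s, ENNReal.ofReal (qf P v) ≤
      ENNReal.ofReal ‖(inner ℂ (v : E) (D v) : ℂ)‖ := by
    intro v
    refine ENNReal.ofReal_le_ofReal ?_
    by_cases hv : (v : E) ∈ (Subtype.val '' w : Set E)
    · obtain ⟨k, -, hk⟩ := hv
      have hvK : (v : E) ∈ K := hk ▸ k.2
      rw [hD, hNK _ hvK, inner_zero_right, sub_zero]
      exact (Complex.abs_re_le_norm _).trans' (le_abs_self _)
    · have horth : ∀ k : K, (inner ℂ (v : E) (k : E) : ℂ) = 0 := by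
        intro k
        have h1 := (b.hasSum_repr k).mapL (K.subtypeL)
        have h2 := h1.mapL (innerSL ℂ (v : E))
        refine h2.unique ?_
        convert hasSum_zero with i
        have hi : ((b i : K) : E) ∈ (Subtype.val '' w : Set E) := by
          rw [hb]; exact ⟨i, i.2, rfl⟩
        have hne : v ≠ ⟨_, hsub hi⟩ := fun h => hv (by rw [h]; exact hi)
        have := hs.1.2 hne
        simp only [map_smul, smul_eq_mul, innerSL_apply_apply,
          Submodule.subtypeL_apply] at this ⊢
        rw [this, mul_zero]
      have h0 : qf P v = 0 := by
        have := horth ⟨P v, Submodule.le_topologicalClosure _ ⟨_, rfl⟩⟩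
        simp only at this
        rw [qf, this, Complex.zero_re]
      rw [h0]; positivity
  rw [hs.traceENN_eq hP]
  refine (ENNReal.tsum_le_tsum hterm).trans (ENNReal.summable.tsum_le_of_sum_le fun t => ?_)
  let e := t.equivFin.symm
  have he : Orthonormal ℂ fun i => ((e i : s) : E) :=
    hs.1.comp (fun i => (e i : s)) (Subtype.val_injective.comp e.injective)
  refine le_trans (le_of_eq ?_) (le_iSup_of_le t.card (le_iSup_of_le _ (le_iSup_of_le _
    (le_iSup_of_le he (le_iSup_of_le he le_rfl)))))
  rw [← Finset.sum_coe_sort t]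
  exact (Equiv.sum_comp e fun v : t =>
    ENNReal.ofReal ‖(inner ℂ ((v : s) : E) (D (v : s)) : ℂ)‖).symm

/-- Jordan decomposition of the difference of two positive operators. -/
theorem PosTr.exists_jordan {A B : E →L[ℂ] E} (hA : PosTr A) (hB : PosTr B)
    (hfin : traceNorm (A - B) ≠ ∞) :
    ∃ P N : E →L[ℂ] E, PosTr P ∧ PosTr N ∧ A + N = B + P ∧
      traceENN P ≤ traceNorm (A - B) ∧ traceENN N ≤ traceNorm (A - B) := by
  set D := A - B with hDdef
  have hD : IsSelfAdjoint D := hA.1.isSelfAdjoint.sub hB.1.isSelfAdjoint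
  have hP : (D⁺).IsPositive :=
    (ContinuousLinearMap.nonneg_iff_isPositive _).1 (CFC.posPart_nonneg D)
  have hN : (D⁻).IsPositive :=
    (ContinuousLinearMap.nonneg_iff_isPositive _).1 (CFC.negPart_nonneg D)
  have hsub : D⁺ - D⁻ = D := CFC.posPart_sub_negPart D hD
  have h1 : traceENN D⁺ ≤ traceNorm D := by
    refine traceENN_le_traceNorm (N := D⁻) hP (fun x => ?_) fun v => ?_
    · exact congrArg (fun T : E →L[ℂ] E => T x) (CFC.negPart_mul_posPart D)
    · conv_lhs => rw [← hsub]
      simp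
  have h2 : traceENN D⁻ ≤ traceNorm D := by
    refine traceENN_le_traceNorm (N := D⁺) hN (fun x => ?_) fun v => ?_
    · exact congrArg (fun T : E →L[ℂ] E => T x) (CFC.posPart_mul_negPart D)
    · conv_lhs => rw [← hsub]
      rw [norm_sub_rev]
      simp
  refine ⟨D⁺, D⁻, ⟨hP, ne_top_of_le_ne_top hfin h1⟩, ⟨hN, ne_top_of_le_ne_top hfin h2⟩, ?_, h1, h2⟩
  have : A - B = D⁺ - D⁻ := by rw [hsub]
  rw [sub_eq_sub_iff_add_eq_add] at this
  rw [this, add_comm]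

/-- Positive additive functionals dominated by the trace are Lipschitz. -/
theorem PosAdditive.abs_sub_le {L : (E →L[ℂ] E) → ℝ} (hL : PosAdditive L) {C d : ℝ}
    (hC : 0 ≤ C) (h0 : ∀ A, PosTr A → 0 ≤ L A) (hLC : ∀ A, PosTr A → L A ≤ C * trR A)
    {A B : E →L[ℂ] E} (hA : PosTr A) (hB : PosTr B) (hd : 0 ≤ d)
    (hAB : traceNorm (A - B) ≤ ENNReal.ofReal d) : |L A - L B| ≤ C * d := by
  obtain ⟨P, N, hP, hN, he, h1, h2⟩ :=
    hA.exists_jordan hB (ne_top_of_le_ne_top ENNReal.ofReal_ne_top hAB)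
  have hsum := congrArg L he
  rw [hL _ _ hA hN, hL _ _ hB hP] at hsum
  have hPd : trR P ≤ d := ENNReal.toReal_le_of_le_ofReal hd (h1.trans hAB)
  have hNd : trR N ≤ d := ENNReal.toReal_le_of_le_ofReal hd (h2.trans hAB)
  have := hLC P hP
  have := hLC N hN
  have := h0 P hP
  have := h0 N hN
  have := mul_le_mul_of_nonneg_left hPd hC
  have := mul_le_mul_of_nonneg_left hNd hC
  rw [abs_le]
  constructor <;> linarith

theorem isONB_stdONB : IsONB (stdONB E) := (exists_isONB E).choose_spec

theorem traceC_mul_rankOne (B : E →L[ℂ] E) (v : E) :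
    traceC (B * rankOne v) = inner ℂ v (B v) := by
  obtain ⟨b, hb⟩ := (isONB_stdONB (E := E)).exists_hilbertBasis
  rw [← b.tsum_inner_mul_inner v (B v), hb, traceC]
  refine tsum_congr fun u => ?_
  simp [rankOne_apply]

theorem traceC_rankOne_mul (B : E →L[ℂ] E) (x : E) :
    traceC (rankOne x * B) = inner ℂ x (B x) := by
  obtain ⟨b, hb⟩ := (isONB_stdONB (E := E)).exists_hilbertBasis
  rw [← ContinuousLinearMap.adjoint_inner_left, ← b.tsum_inner_mul_inner, hb, traceC]
  refine tsum_congr fun u => ?_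
  simp [rankOne_apply, ContinuousLinearMap.adjoint_inner_left]

theorem inner_dual_rankOne {Φ : TraceMap E F} {Φstar : (F →L[ℂ] F) → (E →L[ℂ] E)}
    (hdual : ∀ (ρ : E →L[ℂ] E) (B : F →L[ℂ] F), IsTC ρ →
      traceC (Φ.toFun ρ * B) = traceC (ρ * Φstar B)) (x : E) (v : F) :
    (inner ℂ x (Φstar (rankOne v) x) : ℂ) = inner ℂ v (Φ.toFun (rankOne x) v) := by
  rw [← traceC_rankOne_mul, ← traceC_mul_rankOne, hdual _ _ (posTr_rankOne x).isTC]

end Additive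

/-! ### Convergence of sums -/

section Sums

variable {ι α : Type*} {l : Filter α}

theorem exists_finset_tail_lt {f : ι → α → ℝ} {f₀ : ι → ℝ}
    (hf : ∀ i, Tendsto (f i) l (𝓝 (f₀ i))) (hs₀ : Summable f₀)
    (hsum : Tendsto (fun a => ∑' i, f i a) l (𝓝 (∑' i, f₀ i))) {ε : ℝ} (hε : 0 < ε) :
    ∃ t : Finset ι, ∑' i, f₀ i - ∑ i ∈ t, f₀ i < ε ∧
      ∀ᶠ a in l, ∑' i, f i a - ∑ i ∈ t, f i a < ε := by
  have h := (hs₀.hasSum.const_sub (∑' i, f₀ i) : Tendsto _ _ _)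
  rw [sub_self] at h
  obtain ⟨t, ht⟩ := (h.eventually_lt_const hε).exists
  exact ⟨t, ht, (hsum.sub (tendsto_finsetSum t fun i _ => hf i)).eventually_lt_const ht⟩

/-- Dominated convergence for series with a variable dominating series. -/
theorem tendsto_tsum_of_dominated_of_tendsto {f g : ι → α → ℝ} {f₀ g₀ : ι → ℝ}
    (hf : ∀ i, Tendsto (f i) l (𝓝 (f₀ i))) (hg : ∀ i, Tendsto (g i) l (𝓝 (g₀ i)))
    (hsg : ∀ᶠ a in l, Summable fun i => g i a) (hsg₀ : Summable g₀)
    (hfg : ∀ᶠ a in l, ∀ i, 0 ≤ f i a ∧ f i a ≤ g i a)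
    (hfg₀ : ∀ i, 0 ≤ f₀ i ∧ f₀ i ≤ g₀ i)
    (hsum : Tendsto (fun a => ∑' i, g i a) l (𝓝 (∑' i, g₀ i))) :
    Tendsto (fun a => ∑' i, f i a) l (𝓝 (∑' i, f₀ i)) := by
  have tail : ∀ {x y : ι → ℝ} (t : Finset ι), (∀ i, 0 ≤ x i ∧ x i ≤ y i) → Summable y →
      0 ≤ ∑' i, x i - ∑ i ∈ t, x i ∧
        ∑' i, x i - ∑ i ∈ t, x i ≤ ∑' i, y i - ∑ i ∈ t, y i := by
    intro x y t hxy hy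
    have hx : Summable x := hy.of_nonneg_of_le (fun i => (hxy i).1) fun i => (hxy i).2
    refine ⟨sub_nonneg.2 (hx.sum_le_tsum t fun i _ => (hxy i).1), ?_⟩
    have := (hy.sub hx).sum_le_tsum t fun i _ => sub_nonneg.2 (hxy i).2
    rw [hy.tsum_sub hx, Finset.sum_sub_distrib] at this
    linarith
  rw [Metric.tendsto_nhds]
  intro ε hε
  obtain ⟨t, ht, htl⟩ := exists_finset_tail_lt hg hsg₀ hsum (ε := ε / 3) (by positivity)
  have hfin := (Metric.tendsto_nhds.1 (tendsto_finsetSum t fun i _ => hf i)) (ε / 3)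
    (by positivity)
  filter_upwards [htl, hfin, hsg, hfg] with a h1 h2 h3 h4
  have h5 := tail t h4 h3
  have h6 := tail t hfg₀ hsg₀
  rw [Real.dist_eq, abs_lt] at h2 ⊢
  constructor <;> linarith [h2.1, h2.2, h5.1, h5.2, h6.1, h6.2]

end Sums

/-! ### Entropy in terms of `gfun` -/

section Entropy

variable {E F : Type*}
variable [NormedAddCommGroup E] [InnerProductSpace ℂ E] [CompleteSpace E]
variable [NormedAddCommGroup F] [InnerProductSpace ℂ F] [CompleteSpace F]

/-- The sum of `gfun` over the diagonal of `A` with respect to `s`. -/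
def sumG (s : Set F) (A : F →L[ℂ] F) : ℝ≥0∞ := ∑' v : s, ENNReal.ofReal (gfun (qf A v))

/-- The infimum of `sumG` over all orthonormal bases. -/
def gEnt (A : F →L[ℂ] F) : ℝ≥0∞ := ⨅ (s : Set F) (_ : IsONB s), sumG s A

theorem clEntropy_add {A : F →L[ℂ] F} (hA : PosTr A) (h1 : trR A ≤ 1) {s : Set F}
    (hs : IsONB s) :
    clEntropy (fun v : s => qf A v) + ENNReal.ofReal (gfun (trR A)) = sumG s A := by
  have h := hA.hasSum hs
  rw [← h.tsum_eq]
  exact clEntropy_add_gfun (fun v => qf_nonneg hA.1 _) h.summable (by rwa [h.tsum_eq])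

theorem qEntropy_add {A : F →L[ℂ] F} (hA : PosTr A) (h1 : trR A ≤ 1) :
    qEntropy A + ENNReal.ofReal (gfun (trR A)) = gEnt A := by
  unfold qEntropy gEnt
  simp only [ENNReal.iInf_add]
  exact iInf_congr fun s => iInf_congr fun hs => clEntropy_add hA h1 hs

theorem gEnt_le {A : F →L[ℂ] F} {s : Set F} (hs : IsONB s) : gEnt A ≤ sumG s A :=
  iInf₂_le s hs

theorem qf_mem_Icc {A : F →L[ℂ] F} (hA : PosTr A) (h1 : trR A ≤ 1) {u : F} (hu : ‖u‖ ≤ 1) :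
    qf A u ∈ Set.Icc (0 : ℝ) 1 := ⟨qf_nonneg hA.1 u, (hA.qf_le hu).trans h1⟩

/-- Every finite-dimensional subspace has an orthonormal basis in which the diagonal sum
of `gfun` of the compression of `A` does not exceed the one of `A` in any basis. -/
theorem exists_basis_sum_gfun_le {A : F →L[ℂ] F} (hA : PosTr A) (h1 : trR A ≤ 1)
    (W : Submodule ℂ F) [FiniteDimensional ℂ W] :
    ∃ u : OrthonormalBasis (Fin (Module.finrank ℂ W)) ℂ W, ∀ s : Set F, IsONB s →
      ∑ j, ENNReal.ofReal (gfun (qf A (u j : F))) ≤ sumG s A := by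
  obtain ⟨B, hB, hBB, hq⟩ := exists_sqrt hA.1
  let T : W →ₗ[ℂ] W := ((W.orthogonalProjectionOnto ∘L A ∘L W.subtypeL : W →L[ℂ] W) : W →ₗ[ℂ] W)
  have hTinner : ∀ x y : W, (inner ℂ x (T y) : ℂ) = inner ℂ (x : F) (A y) := by
    intro x y
    simp [T]
  have hT : T.IsSymmetric := by
    intro x y
    rw [hTinner, ← inner_conj_symm, hTinner, inner_conj_symm]
    exact hA.1.inner_left_eq_inner_right _ _
  let u := hT.eigenvectorBasis rfl
  have hu : Orthonormal ℂ fun j => (u j : F) := u.orthonormal.comp_linearIsometry W.subtypeₗᵢ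
  have hoff : ∀ j k, (inner ℂ (B (u j)) (B (u k)) : ℂ) =
      if j = k then (qf A (u k) : ℂ) else 0 := by
    intro j k
    split_ifs with hjk
    · subst hjk
      rw [inner_self_eq_norm_sq_to_K, hq]; norm_cast
    · rw [hB, ← hBB, ← hTinner, hT.apply_eigenvectorBasis, inner_smul_right,
        u.orthonormal.2 hjk, mul_zero]
  refine ⟨u, fun s hs => ?_⟩
  let J := Finset.univ.filter fun j => qf A (u j) ≠ 0
  have hpos : ∀ j ∈ J, 0 < qf A (u j) := fun j hj =>
    lt_of_le_of_ne (qf_nonneg hA.1 _) (Finset.mem_filter.1 hj).2.symm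
  -- the normalized images of the eigenvectors under the square root
  let w : Fin (Module.finrank ℂ W) → F := fun j => ((Real.sqrt (qf A (u j)) : ℂ))⁻¹ • B (u j)
  have hw : Orthonormal ℂ fun j : J => w j := by
    rw [orthonormal_iff_ite]
    intro j k
    simp only [w]
    rw [inner_smul_left, inner_smul_right, hoff]
    by_cases hjk : j = k
    · subst hjk
      have := Real.sqrt_pos.2 (hpos j j.2)
      have h2 := Real.mul_self_sqrt (hpos j j.2).le
      simp only [if_true, map_inv₀, Complex.conj_ofReal]
      norm_cast
      field_simp
      nlinarith
    · have : (j : Fin (Module.finrank ℂ W)) ≠ (k : Fin (Module.finrank ℂ W)) := fun h => hjk (Subtype.ext h)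
      simp [hjk, this]
  have hwB : ∀ j ∈ J, ∀ v, ‖(inner ℂ (u j : F) (B v) : ℂ)‖ ^ 2 =
      ‖(inner ℂ (w j) v : ℂ)‖ ^ 2 * qf A (u j) := by
    intro j hj v
    have h2 := Real.sq_sqrt (hpos j hj).le
    have h3 := Real.sqrt_pos.2 (hpos j hj)
    simp only [w]
    rw [inner_smul_left, hB, norm_mul, mul_pow]
    simp only [map_inv₀, Complex.conj_ofReal, norm_inv, Complex.norm_real, Real.norm_eq_abs,
      abs_of_pos h3, inv_pow, h2]
    field_simp [(hpos j hj).ne']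
  have hterm : ∀ v : s, ∑ j ∈ J, ‖(inner ℂ (v : F) (w j) : ℂ)‖ ^ 2 * gfun (qf A (u j)) ≤
      gfun (qf A v) := by
    intro v
    have hv : ‖(v : F)‖ = 1 := hs.1.1 v
    have hbes : ∑ j ∈ J, ‖(inner ℂ (v : F) (w j) : ℂ)‖ ^ 2 ≤ 1 := by
      have := hw.besselFam Finset.univ (v : F)
      rw [Finset.univ_eq_attach, Finset.sum_attach J fun j => ‖(inner ℂ (w j) (v : F) : ℂ)‖ ^ 2,
        hv, one_pow] at this
      simpa only [norm_inner_symm (v : F)] using this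
    refine (sum_mul_gfun_le J (fun _ _ => by positivity) (fun j hj => (hpos j hj).le) hbes).trans ?_
    refine gfun_mono (Finset.sum_nonneg fun j hj => mul_nonneg (by positivity) (hpos j hj).le) ?_
      (qf_mem_Icc hA h1 hv.le).2
    rw [hq]
    refine le_trans ?_ (hu.besselFam J (B v))
    refine Finset.sum_le_sum fun j hj => ?_
    rw [hwB j hj, norm_inner_symm]
  have hg0 : ∀ j, 0 ≤ gfun (qf A (u j)) := fun j =>
    have h := qf_mem_Icc hA h1 (hu.1 j).le
    gfun_nonneg h.1 h.2
  calc ∑ j, ENNReal.ofReal (gfun (qf A (u j)))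
      = ∑ j ∈ J, ENNReal.ofReal (gfun (qf A (u j))) := by
        symm
        refine Finset.sum_subset (Finset.subset_univ _) fun j _ hj => ?_
        have : qf A (u j) = 0 := by simpa [J] using hj
        simp [this]
    _ = ∑ j ∈ J, ∑' v : s, ENNReal.ofReal
          (‖(inner ℂ (v : F) (w j) : ℂ)‖ ^ 2 * gfun (qf A (u j))) := by
        refine Finset.sum_congr rfl fun j hj => ?_
        simp_rw [ENNReal.ofReal_mul (sq_nonneg ‖(inner ℂ _ (w j) : ℂ)‖)]
        rw [ENNReal.tsum_mul_right, hs.tsum_ofReal_norm_inner_sq, hw.1 ⟨j, hj⟩]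
        simp
    _ = ∑' v : s, ∑ j ∈ J, ENNReal.ofReal
          (‖(inner ℂ (v : F) (w j) : ℂ)‖ ^ 2 * gfun (qf A (u j))) :=
        (Summable.tsum_finsetSum fun _ _ => ENNReal.summable).symm
    _ ≤ _ := by
        refine ENNReal.tsum_le_tsum fun v => ?_
        rw [← ENNReal.ofReal_sum_of_nonneg fun j _ => mul_nonneg (by positivity) (hg0 j)]
        exact ENNReal.ofReal_le_ofReal (hterm v)

/-- Replacing finitely many basis vectors by another orthonormal basis of their span. -/
theorem IsONB.replace {s : Set F} (hs : IsONB s) (t : Finset s) {n : ℕ}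
    {W : Submodule ℂ F} (hW : W = Submodule.span ℂ (((↑) : s → F) '' (t : Set s)))
    (u : OrthonormalBasis (Fin n) ℂ W) :
    IsONB (Set.range (fun j => (u j : F)) ∪ ((↑) : s → F) '' ((t : Set s)ᶜ)) := by
  have hu : Orthonormal ℂ fun j => (u j : F) := u.orthonormal.comp_linearIsometry W.subtypeₗᵢ
  have hperp : ∀ x ∈ W, ∀ v : s, v ∉ t → (inner ℂ x (v : F) : ℂ) = 0 := by
    intro x hx v hv
    rw [hW] at hx
    induction hx using Submodule.span_induction with
    | mem x hx =>
      obtain ⟨y, hy, rfl⟩ := hx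
      exact hs.1.2 fun h => hv (h ▸ hy)
    | zero => simp
    | add x y _ _ hx hy => rw [inner_add_left, hx, hy, add_zero]
    | smul c x _ hx => rw [inner_smul_left, hx, mul_zero]
  refine ⟨⟨?_, ?_⟩, ?_⟩
  · rintro ⟨_, ⟨j, rfl⟩ | ⟨v, -, rfl⟩⟩
    · exact hu.1 j
    · exact hs.1.1 v
  · rintro ⟨_, ⟨j, rfl⟩ | ⟨v, hv, rfl⟩⟩ ⟨_, ⟨k, rfl⟩ | ⟨w, hw, rfl⟩⟩ hne
    · exact hu.2 fun h => hne (by subst h; rfl)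
    · exact hperp _ (u j).2 w hw
    · exact inner_eq_zero_symm.1 (hperp _ (u k).2 v hv)
    · exact hs.1.2 fun h => hne (by subst h; rfl)
  · refine hs.2.mono ?_
    refine Submodule.span_le.2 fun v hv => ?_
    by_cases hvt : (⟨v, hv⟩ : s) ∈ t
    · have hvW : v ∈ W := hW ▸ Submodule.subset_span ⟨⟨v, hv⟩, hvt, rfl⟩
      have := congrArg (fun x : W => (x : F)) (u.sum_repr ⟨v, hvW⟩)
      simp only [Submodule.coe_sum, Submodule.coe_smul] at this
      rw [← this]
      exact Submodule.sum_mem _ fun j _ => Submodule.smul_mem _ _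
        (Submodule.subset_span (Or.inl ⟨j, rfl⟩))
    · exact Submodule.subset_span (Or.inr ⟨⟨v, hv⟩, hvt, rfl⟩)

theorem gEnt_le_gEnt_add {A B : F →L[ℂ] F} (hB : PosTr B) (hB1 : trR B ≤ 1) {s : Set F}
    (hs : IsONB s) (t : Finset s) {ω : ℝ}
    (hAB : ∀ u : F, ‖u‖ ≤ 1 → gfun (qf A u) ≤ gfun (qf B u) + ω) :
    gEnt A ≤ gEnt B + ENNReal.ofReal (t.card * ω) +
      ∑' v : ((t : Set s)ᶜ : Set s), ENNReal.ofReal (gfun (qf A (v : s))) := by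
  set W := Submodule.span ℂ (((↑) : s → F) '' (t : Set s)) with hW
  have hfin : (((↑) : s → F) '' (t : Set s)).Finite := t.finite_toSet.image _
  have : FiniteDimensional ℂ W := FiniteDimensional.span_of_finite ℂ hfin
  have hcard : Module.finrank ℂ W ≤ t.card := by
    have := finrank_span_finset_le_card (R := ℂ) (t.image ((↑) : s → F))
    rw [Set.finrank, Finset.coe_image] at this
    exact this.trans Finset.card_image_le
  obtain ⟨u, hu⟩ := exists_basis_sum_gfun_le hB hB1 W
  have hon : Orthonormal ℂ fun j => (u j : F) := u.orthonormal.comp_linearIsometry W.subtypeₗᵢ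
  refine (gEnt_le (hs.replace t hW u)).trans ?_
  refine (ENNReal.tsum_union_le (fun v : F => ENNReal.ofReal (gfun (qf A v))) _ _).trans ?_
  refine add_le_add ?_ (le_of_eq ?_)
  · rw [tsum_range (fun v : F => ENNReal.ofReal (gfun (qf A v))) hon.linearIndependent.injective,
      tsum_fintype]
    have h1 : ∑ j, ENNReal.ofReal (gfun (qf B (u j : F))) ≤ gEnt B := le_iInf₂ hu
    refine le_trans ?_ (add_le_add_left h1 _)
    calc ∑ j, ENNReal.ofReal (gfun (qf A (u j : F)))
        ≤ ∑ j, (ENNReal.ofReal (gfun (qf B (u j : F))) + ENNReal.ofReal ω) := by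
          refine Finset.sum_le_sum fun j _ => ?_
          exact (ENNReal.ofReal_le_ofReal (hAB _ (hon.1 j).le)).trans ENNReal.ofReal_add_le
      _ ≤ _ := by
          rw [Finset.sum_add_distrib]
          refine add_le_add_right ?_ _
          rw [Finset.sum_const, Finset.card_univ, Fintype.card_fin, nsmul_eq_mul,
            ENNReal.ofReal_mul (Nat.cast_nonneg _), ENNReal.ofReal_natCast]
          gcongr
  · exact tsum_image (fun v : F => ENNReal.ofReal (gfun (qf A v))) Subtype.val_injective.injOn

end Entropy

/-! ### Continuity along states converging in trace norm -/

section Continuity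

variable {E F : Type*}
variable [NormedAddCommGroup E] [InnerProductSpace ℂ E] [CompleteSpace E]
variable [NormedAddCommGroup F] [InnerProductSpace ℂ F] [CompleteSpace F]

/-- The filter of states approaching `A` in trace norm. -/
def nearStates (A : E →L[ℂ] E) : Filter (E →L[ℂ] E) :=
  comap (fun B => traceNorm (B - A)) (𝓝 0) ⊓ 𝓟 (states E)

theorem nearStates_hasBasis (A : E →L[ℂ] E) : (nearStates A).HasBasis (fun δ : ℝ≥0∞ => 0 < δ)
    fun δ => {B | traceNorm (B - A) < δ} ∩ states E :=
  (ENNReal.nhds_zero_basis.comap _).inf_principal _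

theorem eventually_nearStates_mem (A : E →L[ℂ] E) : ∀ᶠ B in nearStates A, B ∈ states E :=
  mem_inf_of_right (mem_principal_self _)

theorem eventually_nearStates_le (A : E →L[ℂ] E) {δ : ℝ} (hδ : 0 < δ) :
    ∀ᶠ B in nearStates A, traceNorm (B - A) ≤ ENNReal.ofReal δ := by
  filter_upwards [(nearStates_hasBasis A).mem_of_mem (ENNReal.ofReal_pos.2 hδ)] with B hB
  exact hB.1.le

theorem tendsto_nearStates_iff {A : E →L[ℂ] E} {g : (E →L[ℂ] E) → ℝ} {c : ℝ} :
    Tendsto g (nearStates A) (𝓝 c) ↔ ∀ ε : ℝ, 0 < ε → ∃ δ : ℝ, 0 < δ ∧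
      ∀ B ∈ states E, traceNorm (B - A) < ENNReal.ofReal δ → |g B - c| < ε := by
  rw [Metric.tendsto_nhds]
  refine forall₂_congr fun ε _ => ?_
  rw [(nearStates_hasBasis A).eventually_iff]
  constructor
  · rintro ⟨δ, hδ, h⟩
    have h1 : min δ 1 ≠ ∞ := ne_top_of_le_ne_top ENNReal.one_ne_top (min_le_right _ _)
    refine ⟨(min δ 1).toReal, ENNReal.toReal_pos (lt_min hδ one_pos).ne' h1, fun B hB hd => ?_⟩
    rw [ENNReal.ofReal_toReal h1] at hd
    exact h ⟨hd.trans_le (min_le_left _ _), hB⟩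
  · rintro ⟨δ, hδ, h⟩
    exact ⟨ENNReal.ofReal δ, ENNReal.ofReal_pos.2 hδ, fun B hB => h B hB.2 hB.1⟩

theorem contOn_states_iff {f : (E →L[ℂ] E) → ℝ≥0∞} :
    ContOn f (states E) ↔ (∀ A ∈ states E, f A ≠ ∞) ∧ ∀ A ∈ states E,
      Tendsto (fun B => (f B).toReal) (nearStates A) (𝓝 (f A).toReal) := by
  simp only [ContOn, tendsto_nearStates_iff]

theorem PosAdditive.tendsto {L : (E →L[ℂ] E) → ℝ} (hL : PosAdditive L) {C : ℝ}
    (hC : 0 ≤ C) (h0 : ∀ A, PosTr A → 0 ≤ L A) (hLC : ∀ A, PosTr A → L A ≤ C * trR A)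
    {A : E →L[ℂ] E} (hA : A ∈ states E) : Tendsto L (nearStates A) (𝓝 (L A)) := by
  rw [tendsto_nearStates_iff]
  intro ε hε
  refine ⟨ε / (C + 1), by positivity, fun B hB hd => ?_⟩
  refine (hL.abs_sub_le hC h0 hLC (posTr_of_mem_states hB) (posTr_of_mem_states hA)
    (by positivity) hd.le).trans_lt ?_
  rw [mul_div_assoc', div_lt_iff₀ (by positivity)]
  nlinarith

variable {Φ : TraceMap E F}

theorem trR_map_le_one (hΦ : Φ.TNI) {A : E →L[ℂ] E} (hA : A ∈ states E) :
    trR (Φ.toFun A) ≤ 1 :=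
  ((posTr_of_mem_states hA).trR_map_le hΦ).trans (trR_of_mem_states hA).le

theorem PosTr.qf_map_le (hΦ : Φ.TNI) {A : E →L[ℂ] E} (hA : PosTr A) {u : F} (hu : ‖u‖ ≤ 1) :
    qf (Φ.toFun A) u ≤ 1 * trR A := by
  rw [one_mul]
  exact ((hA.map hΦ).qf_le hu).trans (hA.trR_map_le hΦ)

theorem abs_qf_map_sub_le (hΦ : Φ.TNI) {A B : E →L[ℂ] E} (hA : A ∈ states E)
    (hB : B ∈ states E) {d : ℝ} (hd : 0 ≤ d) (h : traceNorm (B - A) ≤ ENNReal.ofReal d)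
    {u : F} (hu : ‖u‖ ≤ 1) : |qf (Φ.toFun B) u - qf (Φ.toFun A) u| ≤ d := by
  have := (Φ.posAdditive_qf u).abs_sub_le zero_le_one
    (fun _ hA => qf_nonneg (hA.map hΦ).1 u) (fun _ hA => hA.qf_map_le hΦ hu)
    (posTr_of_mem_states hB) (posTr_of_mem_states hA) hd h
  simpa using this

theorem tendsto_qf_map (hΦ : Φ.TNI) {A : E →L[ℂ] E} (hA : A ∈ states E) {u : F}
    (hu : ‖u‖ ≤ 1) :
    Tendsto (fun B => qf (Φ.toFun B) u) (nearStates A) (𝓝 (qf (Φ.toFun A) u)) :=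
  (Φ.posAdditive_qf u).tendsto zero_le_one
    (fun _ hA => qf_nonneg (hA.map hΦ).1 u) (fun _ hA => hA.qf_map_le hΦ hu) hA

theorem tendsto_gfun_trR_map (hΦ : Φ.TNI) {A : E →L[ℂ] E} (hA : A ∈ states E) :
    Tendsto (fun B => gfun (trR (Φ.toFun B))) (nearStates A) (𝓝 (gfun (trR (Φ.toFun A)))) :=
  (continuous_gfun.tendsto _).comp <| (TraceMap.posAdditive_trR hΦ).tendsto zero_le_one
    (fun _ _ => trR_nonneg _) (fun _ hA => by rw [one_mul]; exact hA.trR_map_le hΦ) hA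

theorem gfun_trR_map_nonneg (hΦ : Φ.TNI) {A : E →L[ℂ] E} (hA : A ∈ states E) :
    0 ≤ gfun (trR (Φ.toFun A)) := gfun_nonneg (trR_nonneg _) (trR_map_le_one hΦ hA)

theorem gfun_qf_nonneg {A : F →L[ℂ] F} (hA : PosTr A) (h1 : trR A ≤ 1) {u : F} (hu : ‖u‖ ≤ 1) :
    0 ≤ gfun (qf A u) :=
  gfun_nonneg (qf_mem_Icc hA h1 hu).1 (qf_mem_Icc hA h1 hu).2

theorem sumG_toReal {A : F →L[ℂ] F} (hA : PosTr A) (h1 : trR A ≤ 1) {s : Set F}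
    (hs : IsONB s) : (sumG s A).toReal = ∑' v : s, gfun (qf A v) := by
  rw [sumG, ENNReal.tsum_toReal_eq fun _ => ENNReal.ofReal_ne_top]
  exact tsum_congr fun v => ENNReal.toReal_ofReal (gfun_qf_nonneg hA h1 (hs.1.1 v).le)

theorem summable_gfun {A : F →L[ℂ] F} (hA : PosTr A) (h1 : trR A ≤ 1) {s : Set F}
    (hs : IsONB s) (hfin : sumG s A ≠ ∞) : Summable fun v : s => gfun (qf A v) :=
  (ENNReal.summable_toReal hfin).congr fun v =>
    ENNReal.toReal_ofReal (gfun_qf_nonneg hA h1 (hs.1.1 v).le)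

theorem clEntropy_toReal {A : F →L[ℂ] F} (hA : PosTr A) (h1 : trR A ≤ 1) {s : Set F}
    (hs : IsONB s) (hfin : clEntropy (fun v : s => qf A v) ≠ ∞) :
    (clEntropy fun v : s => qf A v).toReal + gfun (trR A) = ∑' v : s, gfun (qf A v) := by
  rw [← sumG_toReal hA h1 hs, ← clEntropy_add hA h1 hs,
    ENNReal.toReal_add hfin ENNReal.ofReal_ne_top,
    ENNReal.toReal_ofReal (gfun_nonneg (trR_nonneg _) h1)]

/-- A uniform energy bound makes the diagonal entropy continuous and bounded. -/
theorem clEntropy_contOn_of_energy (hΦ : Φ.TNI) {s : Set F} (hs : IsONB s) {h : s → ℝ}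
    (h0 : ∀ v, 0 ≤ h v) {C : ℝ}
    (hC : ∀ (t : Finset s) (x : E),
      ∑ v ∈ t, h v * qf (Φ.toFun (rankOne x)) v ≤ C * ‖x‖ ^ 2)
    (hexp : Summable fun v => Real.exp (-h v)) :
    ContOn (fun ρ => clEntropy fun v : s => qf (Φ.toFun ρ) (v : F)) (states E) ∧
      BddOn (fun ρ => clEntropy fun v : s => qf (Φ.toFun ρ) (v : F)) (states E) := by
  wlog hC0 : 0 ≤ C
  · exact this hΦ hs h0 (C := max C 0) (fun t x => (hC t x).trans (by gcongr; exact le_max_left _ _))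
      hexp (le_max_right _ _)
  have hv : ∀ v : s, ‖(v : F)‖ ≤ 1 := fun v => (hs.1.1 v).le
  have hterm : ∀ A : E →L[ℂ] E, PosTr A → ∀ v : s, 0 ≤ h v * qf (Φ.toFun A) v :=
    fun A hA v => mul_nonneg (h0 v) (qf_nonneg (hA.map hΦ).1 _)
  have hfinite : ∀ (t : Finset s) (A : E →L[ℂ] E), PosTr A →
      ∑ v ∈ t, h v * qf (Φ.toFun A) v ≤ C * trR A := by
    intro t A hA
    have hL : PosAdditive fun A : E →L[ℂ] E => ∑ v ∈ t, h v * qf (Φ.toFun A) v := by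
      intro A B hA hB
      simp only [(Φ.posAdditive_qf _) A B hA hB, mul_add, Finset.sum_add_distrib]
    refine hL.le_of_rankOne (K := ∑ v ∈ t, h v) (fun A hA => ?_) (hC t) hA
    rw [Finset.sum_mul]
    refine Finset.sum_le_sum fun v _ => mul_le_mul_of_nonneg_left ?_ (h0 v)
    simpa using hA.qf_map_le hΦ (hv v)
  have hsumm : ∀ A : E →L[ℂ] E, PosTr A → Summable fun v : s => h v * qf (Φ.toFun A) v :=
    fun A hA => summable_of_sum_le (hterm A hA) fun t => hfinite t A hA
  have hWle : ∀ A : E →L[ℂ] E, PosTr A → ∑' v : s, h v * qf (Φ.toFun A) v ≤ C * trR A :=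
    fun A hA => (hsumm A hA).tsum_le_of_sum_le fun t => hfinite t A hA
  have hW : PosAdditive fun A : E →L[ℂ] E => ∑' v : s, h v * qf (Φ.toFun A) v := by
    intro A B hA hB
    simp only [(Φ.posAdditive_qf _) A B hA hB, mul_add]
    exact (hsumm A hA).tsum_add (hsumm B hB)
  have hdom : ∀ A ∈ states E, ∀ v : s, 0 ≤ gfun (qf (Φ.toFun A) v) ∧
      gfun (qf (Φ.toFun A) v) ≤ h v * qf (Φ.toFun A) v + Real.exp (-h v) := by
    intro A hA v
    have hA' := (posTr_of_mem_states hA).map hΦ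
    exact ⟨gfun_qf_nonneg hA' (trR_map_le_one hΦ hA) (hv v), gfun_le (qf_nonneg hA'.1 _) _⟩
  have hsg : ∀ A ∈ states E, Summable fun v : s => h v * qf (Φ.toFun A) v + Real.exp (-h v) :=
    fun A hA => (hsumm A (posTr_of_mem_states hA)).add hexp
  have hbdd : ∀ A ∈ states E, (clEntropy fun v : s => qf (Φ.toFun A) (v : F)) ≤
      ENNReal.ofReal (C + ∑' v, Real.exp (-h v)) := by
    intro A hA
    have hA0 := posTr_of_mem_states hA
    refine (le_self_add.trans
      (clEntropy_add (hA0.map hΦ) (trR_map_le_one hΦ hA) hs).le).trans ?_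
    rw [sumG, ← ENNReal.ofReal_tsum_of_nonneg (fun v => (hdom A hA v).1)
      ((hsg A hA).of_nonneg_of_le (fun v => (hdom A hA v).1) fun v => (hdom A hA v).2)]
    refine ENNReal.ofReal_le_ofReal ?_
    have h1 := ((hsg A hA).of_nonneg_of_le (fun v => (hdom A hA v).1)
      fun v => (hdom A hA v).2).tsum_le_tsum (fun v => (hdom A hA v).2) (hsg A hA)
    rw [(hsumm A hA0).tsum_add hexp] at h1
    have h2 := hWle A hA0
    rw [trR_of_mem_states hA, mul_one] at h2
    linarith
  have hfin : ∀ A ∈ states E, (clEntropy fun v : s => qf (Φ.toFun A) (v : F)) ≠ ∞ :=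
    fun A hA => ne_top_of_le_ne_top ENNReal.ofReal_ne_top (hbdd A hA)
  refine ⟨contOn_states_iff.2 ⟨hfin, fun A hA => ?_⟩, _, hbdd⟩
  have hreal : ∀ A ∈ states E, (clEntropy fun v : s => qf (Φ.toFun A) (v : F)).toReal =
      ∑' v : s, gfun (qf (Φ.toFun A) v) - gfun (trR (Φ.toFun A)) := fun A hA =>
    eq_sub_of_add_eq (clEntropy_toReal ((posTr_of_mem_states hA).map hΦ)
      (trR_map_le_one hΦ hA) hs (hfin A hA))
  rw [hreal A hA]
  refine Tendsto.congr' ((eventually_nearStates_mem A).mono fun B hB => (hreal B hB).symm) ?_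
  refine Tendsto.sub ?_ (tendsto_gfun_trR_map hΦ hA)
  refine tendsto_tsum_of_dominated_of_tendsto
    (g := fun v B => h v * qf (Φ.toFun B) v + Real.exp (-h v))
    (fun v => (continuous_gfun.tendsto _).comp (tendsto_qf_map hΦ hA (hv v)))
    (fun v => ((tendsto_qf_map hΦ hA (hv v)).const_mul _).add_const _)
    ((eventually_nearStates_mem A).mono hsg) (hsg A hA)
    ((eventually_nearStates_mem A).mono hdom) (hdom A hA) ?_
  rw [(hsumm A (posTr_of_mem_states hA)).tsum_add hexp]
  refine Tendsto.congr' ((eventually_nearStates_mem A).mono fun B hB =>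
    ((hsumm B (posTr_of_mem_states hB)).tsum_add hexp).symm) ?_
  exact (hW.tendsto hC0 (fun A hA => tsum_nonneg (hterm A hA)) hWle hA).add_const _

theorem tsum_compl_ofReal_gfun {A : F →L[ℂ] F} (hA : PosTr A) (h1 : trR A ≤ 1) {s : Set F}
    (hs : IsONB s) (hfin : sumG s A ≠ ∞) (t : Finset s) :
    ∑' v : ((t : Set s)ᶜ : Set s), ENNReal.ofReal (gfun (qf A (v : s))) =
      ENNReal.ofReal (∑' v : s, gfun (qf A v) - ∑ v ∈ t, gfun (qf A v)) := by
  have hsum := summable_gfun hA h1 hs hfin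
  have h2 := hsum.sum_add_tsum_compl (s := t)
  rw [← h2, add_sub_cancel_left]
  exact (ENNReal.ofReal_tsum_of_nonneg
    (f := fun v : ((t : Set s)ᶜ : Set s) => gfun (qf A (v : s)))
    (fun v => gfun_qf_nonneg hA h1 (hs.1.1 (v : s)).le) (hsum.subtype (t : Set s)ᶜ)).symm

/-- Continuity of the diagonal entropy in one basis implies continuity of the quantum
entropy. -/
theorem outEntropy_contOn_of_clEntropy (hΦ : Φ.TNI) {s : Set F} (hs : IsONB s)
    (hcont : ContOn (fun ρ => clEntropy fun v : s => qf (Φ.toFun ρ) (v : F)) (states E)) :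
    ContOn (outEntropy Φ) (states E) := by
  rw [contOn_states_iff] at hcont ⊢
  obtain ⟨hclfin, hcl⟩ := hcont
  have hpos : ∀ A ∈ states E, PosTr (Φ.toFun A) := fun A hA => (posTr_of_mem_states hA).map hΦ
  have hsG : ∀ A ∈ states E, sumG s (Φ.toFun A) ≠ ∞ := fun A hA => by
    rw [← clEntropy_add (hpos A hA) (trR_map_le_one hΦ hA) hs]
    exact ENNReal.add_ne_top.2 ⟨hclfin A hA, ENNReal.ofReal_ne_top⟩
  have hgE : ∀ A ∈ states E, gEnt (Φ.toFun A) ≠ ∞ := fun A hA =>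
    ne_top_of_le_ne_top (hsG A hA) (gEnt_le hs)
  have hqE : ∀ A ∈ states E, outEntropy Φ A ≠ ∞ := fun A hA =>
    ne_top_of_le_ne_top (hgE A hA)
      (le_self_add.trans (qEntropy_add (hpos A hA) (trR_map_le_one hΦ hA)).le)
  refine ⟨hqE, fun A hA => ?_⟩
  have hreal : ∀ A ∈ states E, (outEntropy Φ A).toReal =
      (gEnt (Φ.toFun A)).toReal - gfun (trR (Φ.toFun A)) := fun A hA => by
    rw [outEntropy, ← qEntropy_add (hpos A hA) (trR_map_le_one hΦ hA),
      ENNReal.toReal_add (show qEntropy (Φ.toFun A) ≠ ∞ from hqE A hA) ENNReal.ofReal_ne_top,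
      ENNReal.toReal_ofReal (gfun_trR_map_nonneg hΦ hA), add_sub_cancel_right]
  rw [hreal A hA]
  refine Tendsto.congr' ((eventually_nearStates_mem A).mono fun B hB => (hreal B hB).symm) ?_
  refine Tendsto.sub ?_ (tendsto_gfun_trR_map hΦ hA)
  rw [Metric.tendsto_nhds]
  intro ε hε
  have hsum : Tendsto (fun B => ∑' v : s, gfun (qf (Φ.toFun B) v)) (nearStates A)
      (𝓝 (∑' v : s, gfun (qf (Φ.toFun A) v))) := by
    have hc : ∀ A ∈ states E, ∑' v : s, gfun (qf (Φ.toFun A) v) =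
        (clEntropy fun v : s => qf (Φ.toFun A) (v : F)).toReal + gfun (trR (Φ.toFun A)) :=
      fun A hA => (clEntropy_toReal (hpos A hA) (trR_map_le_one hΦ hA) hs (hclfin A hA)).symm
    rw [hc A hA]
    exact Tendsto.congr' ((eventually_nearStates_mem A).mono fun B hB => (hc B hB).symm)
      ((hcl A hA).add (tendsto_gfun_trR_map hΦ hA))
  obtain ⟨t, htA, htB⟩ := exists_finset_tail_lt
    (fun v : s => (continuous_gfun.tendsto _).comp (tendsto_qf_map hΦ hA (hs.1.1 v).le))
    (summable_gfun (hpos A hA) (trR_map_le_one hΦ hA) hs (hsG A hA)) hsum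
    (ε := ε / 3) (by positivity)
  set ω : ℝ := ε / 3 / (t.card + 1) with hω
  have hω0 : 0 < ω := by positivity
  have hcard : t.card * ω < ε / 3 := by
    rw [hω, mul_div_assoc', div_lt_iff₀ (by positivity)]
    nlinarith
  obtain ⟨δ, hδ, hδω⟩ := Metric.uniformContinuousOn_iff.1
    (isCompact_Icc.uniformContinuousOn_of_continuous
      (continuous_gfun.continuousOn (s := Set.Icc (0 : ℝ) 1))) ω hω0
  filter_upwards [eventually_nearStates_mem A, htB,
    eventually_nearStates_le A (half_pos hδ)] with B hB htB hd
  have hclose : ∀ u : F, ‖u‖ ≤ 1 →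
      |gfun (qf (Φ.toFun B) u) - gfun (qf (Φ.toFun A) u)| < ω := fun u hu =>
    hδω _ (qf_mem_Icc (hpos B hB) (trR_map_le_one hΦ hB) hu) _
      (qf_mem_Icc (hpos A hA) (trR_map_le_one hΦ hA) hu)
      ((abs_qf_map_sub_le hΦ hA hB (half_pos hδ).le hd hu).trans_lt (half_lt_self hδ))
  have key : ∀ A ∈ states E, ∀ B ∈ states E,
      (∀ u : F, ‖u‖ ≤ 1 → gfun (qf (Φ.toFun A) u) ≤ gfun (qf (Φ.toFun B) u) + ω) →
      ∑' v : s, gfun (qf (Φ.toFun A) v) - ∑ v ∈ t, gfun (qf (Φ.toFun A) v) < ε / 3 →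
      (gEnt (Φ.toFun A)).toReal < (gEnt (Φ.toFun B)).toReal + ε := by
    intro A hA B hB hAB ht
    have h := gEnt_le_gEnt_add (hpos B hB) (trR_map_le_one hΦ hB) hs t hAB
    rw [tsum_compl_ofReal_gfun (hpos A hA) (trR_map_le_one hΦ hA) hs (hsG A hA)] at h
    have h' := h.trans (add_le_add_right (ENNReal.ofReal_le_ofReal ht.le) _)
    rw [add_assoc, ← ENNReal.ofReal_add (by positivity) (by positivity)] at h'
    have h2 := ENNReal.toReal_mono (ENNReal.add_ne_top.2 ⟨hgE B hB, ENNReal.ofReal_ne_top⟩) h'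
    rw [ENNReal.toReal_add (hgE B hB) ENNReal.ofReal_ne_top,
      ENNReal.toReal_ofReal (by positivity)] at h2
    linarith
  rw [Real.dist_eq, abs_lt]
  have h1 := key B hB A hA (fun u hu => by linarith [(abs_lt.1 (hclose u hu)).2]) htB
  have h2 := key A hA B hB (fun u hu => by linarith [(abs_lt.1 (hclose u hu)).1]) htA
  constructor <;> linarith

end Continuity

/-! ### Uniform boundedness of a finite output entropy -/

section Bounded

variable {E F : Type*}
variable [NormedAddCommGroup E] [InnerProductSpace ℂ E] [CompleteSpace E]
variable [NormedAddCommGroup F] [InnerProductSpace ℂ F] [CompleteSpace F]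

theorem PosTr.norm_le {A : E →L[ℂ] E} (hA : PosTr A) : ‖A‖ ≤ trR A := by
  obtain ⟨B, -, hBB, hq⟩ := exists_sqrt hA.1
  have hB : ‖B‖ ≤ Real.sqrt (trR A) := by
    refine B.opNorm_le_of_unit_norm (Real.sqrt_nonneg _) fun x hx => ?_
    refine Real.le_sqrt_of_sq_le ?_
    rw [← hq]
    exact hA.qf_le hx.le
  have hAB : A = B * B := by ext x; exact hBB x
  calc ‖A‖ ≤ ‖B‖ * ‖B‖ := by rw [hAB]; exact norm_mul_le _ _
    _ ≤ Real.sqrt (trR A) * Real.sqrt (trR A) := by gcongr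
    _ = trR A := Real.mul_self_sqrt (trR_nonneg A)

theorem hasSum_qf {ι : Type*} {f : ι → E →L[ℂ] E} {A : E →L[ℂ] E} (h : HasSum f A) (x : E) :
    HasSum (fun i => qf (f i) x) (qf A x) := by
  have h1 := ((innerSL ℂ x).hasSum
    ((ContinuousLinearMap.apply ℂ E x).hasSum h)).mapL Complex.reCLM
  exact h1

theorem isPositive_of_hasSum {ι : Type*} {f : ι → E →L[ℂ] E} {A : E →L[ℂ] E}
    (h : HasSum f A) (hf : ∀ i, (f i).IsPositive) : A.IsPositive := by
  rw [← ContinuousLinearMap.nonneg_iff_isPositive]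
  exact h.nonneg fun i => (ContinuousLinearMap.nonneg_iff_isPositive _).2 (hf i)

theorem traceENN_of_hasSum {ι : Type*} {f : ι → E →L[ℂ] E} {A : E →L[ℂ] E}
    (h : HasSum f A) (hf : ∀ i, (f i).IsPositive) : traceENN A = ∑' i, traceENN (f i) := by
  rw [isONB_stdONB.traceENN_eq (isPositive_of_hasSum h hf)]
  simp_rw [fun i => isONB_stdONB.traceENN_eq (hf i)]
  rw [ENNReal.tsum_comm]
  refine tsum_congr fun v => ?_
  have h1 := hasSum_qf h v
  rw [← h1.tsum_eq, ENNReal.ofReal_tsum_of_nonneg (fun i => qf_nonneg (hf i) _) h1.summable]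

theorem mul_gEnt_le_gEnt_add {A B : F →L[ℂ] F} {r : ℝ} (hA : A.IsPositive) (hB : B.IsPositive)
    (hr0 : 0 ≤ r) (hr1 : r ≤ 1) (hfin : PosTr ((r : ℂ) • A + B))
    (h1 : trR ((r : ℂ) • A + B) ≤ 1) :
    ENNReal.ofReal r * gEnt A ≤ gEnt ((r : ℂ) • A + B) := by
  refine le_iInf₂ fun s hs => ?_
  refine (mul_le_mul_right (gEnt_le hs) _).trans ?_
  rw [sumG, ← ENNReal.tsum_mul_left]
  refine ENNReal.tsum_le_tsum fun v => ?_
  rw [← ENNReal.ofReal_mul hr0]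
  refine ENNReal.ofReal_le_ofReal ((mul_gfun_le hr0 hr1 (qf_nonneg hA _)).trans ?_)
  refine gfun_mono (mul_nonneg hr0 (qf_nonneg hA _)) ?_ (qf_mem_Icc hfin h1 (hs.1.1 v).le).2
  rw [qf_add, qf_smul]
  exact le_add_of_nonneg_right (qf_nonneg hB _)

variable {Φ : TraceMap E F}

theorem exists_gEnt_le (hΦ : Φ.TNI) (hfin : ∀ ρ ∈ states E, gEnt (Φ.toFun ρ) ≠ ∞) :
    ∃ M : ℝ, ∀ ρ ∈ states E, gEnt (Φ.toFun ρ) ≤ ENNReal.ofReal M := by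
  by_contra! hcon
  choose ρ hρ hlarge using fun n : ℕ => hcon ((4 : ℝ) ^ n)
  have hpos := fun n => posTr_of_mem_states (hρ n)
  let r : ℕ → ℝ := fun n => 1 / 2 / 2 ^ n
  have hr0 : ∀ n, 0 ≤ r n := fun n => by positivity
  have hr : HasSum r 1 := hasSum_geometric_two' 1
  have hr1 : ∀ n, r n ≤ 1 := fun n => le_hasSum hr n fun i _ => hr0 i
  have hsummable : Summable fun n => (r n : ℂ) • ρ n := by
    refine Summable.of_norm_bounded hr.summable fun n => ?_
    rw [norm_smul, Complex.norm_real, Real.norm_of_nonneg (hr0 n)]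
    refine mul_le_of_le_one_right (hr0 n) ((hpos n).norm_le.trans ?_)
    exact (trR_of_mem_states (hρ n)).le
  obtain ⟨σ, hσ⟩ := hsummable
  have hp : ∀ n, ((r n : ℂ) • ρ n).IsPositive := fun n => isPositive_smul (hpos n).1 (hr0 n)
  have hstate : σ ∈ states E := by
    refine ⟨isPositive_of_hasSum hσ hp, ?_⟩
    rw [traceENN_of_hasSum hσ hp]
    simp_rw [fun n => traceENN_smul (hpos n).1 (hr0 n), fun n => (hρ n).2, mul_one]
    rw [← ENNReal.ofReal_tsum_of_nonneg hr0 hr.summable, hr.tsum_eq, ENNReal.ofReal_one]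
  have hge : ∀ n : ℕ, ENNReal.ofReal (r n) * gEnt (Φ.toFun (ρ n)) ≤ gEnt (Φ.toFun σ) := by
    intro n
    let τ : E →L[ℂ] E := 0 - (r n : ℂ) • ρ n + σ
    have hτ := hσ.update n 0
    have hτp : ∀ k, (Function.update (fun n => (r n : ℂ) • ρ n) n 0 k).IsPositive := by
      intro k
      by_cases hk : k = n
      · subst hk; simp
      · simpa [Function.update_of_ne hk] using hp k
    have hsplit : σ = (r n : ℂ) • ρ n + τ := by simp [τ]
    have hτpos : PosTr τ := by
      refine ⟨isPositive_of_hasSum hτ hτp, ?_⟩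
      have h1 : traceENN σ = traceENN ((r n : ℂ) • ρ n) + traceENN τ := by
        conv_lhs => rw [hsplit]
        exact traceENN_add (hp n) (isPositive_of_hasSum hτ hτp)
      refine ne_top_of_le_ne_top (b := traceENN σ) (by rw [hstate.2]; exact ENNReal.one_ne_top) ?_
      rw [h1]
      exact le_add_self
    have hmap : Φ.toFun σ = (r n : ℂ) • Φ.toFun (ρ n) + Φ.toFun τ := by
      rw [hsplit, Φ.posAdditive _ _ ((hpos n).smul (hr0 n)) hτpos, Φ.map_smul _ _ (hpos n).isTC]
    have hσ1 := trR_map_le_one hΦ hstate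
    have hσ2 := (posTr_of_mem_states hstate).map hΦ
    rw [hmap] at hσ1 hσ2 ⊢
    exact mul_gEnt_le_gEnt_add ((hpos n).map hΦ).1 (hτpos.map hΦ).1 (hr0 n) (hr1 n) hσ2 hσ1
  refine hfin σ hstate (ENNReal.eq_top_of_forall_nnreal_le fun c => ?_)
  obtain ⟨n, hn⟩ := pow_unbounded_of_one_lt (2 * (c : ℝ)) one_lt_two
  refine le_trans ?_ (hge n)
  refine le_trans ?_ (mul_le_mul_right (hlarge n).le _)
  rw [← ENNReal.ofReal_mul (hr0 n), ← ENNReal.ofReal_coe_nnreal]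
  refine ENNReal.ofReal_le_ofReal ?_
  have h4 : (4 : ℝ) ^ n = 2 ^ n * 2 ^ n := by rw [← mul_pow]; norm_num
  simp only [r]
  rw [h4]
  field_simp
  linarith

/-! ### Truncations of a diagonal of small entropy -/

theorem mul_card_filter_le_gfun {x : ℝ} (h0 : 0 ≤ x) (h1 : x ≤ 1) (N : ℕ) :
    x * ((Finset.range N).filter fun m : ℕ => x < (1 / 4 : ℝ) ^ m).card ≤ gfun x := by
  rcases h0.eq_or_lt with rfl | hx
  · simp
  have hlog : 0 ≤ -Real.log x := neg_nonneg.2 (Real.log_nonpos h0 h1)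
  have hsub : ((Finset.range N).filter fun m : ℕ => x < (1 / 4 : ℝ) ^ m) ⊆
      Finset.range (⌊-Real.log x⌋₊ + 1) := by
    intro m hm
    rw [Finset.mem_range, Nat.lt_succ_iff]
    refine Nat.le_floor ?_
    have h2 := Real.log_lt_log hx (Finset.mem_filter.1 hm).2
    rw [Real.log_pow, one_div, Real.log_inv] at h2
    have h4 : (1 : ℝ) ≤ Real.log 4 := by
      rw [Real.le_log_iff_exp_le (by norm_num)]
      linarith [Real.exp_one_lt_d9]
    nlinarith [(Nat.cast_nonneg m : (0 : ℝ) ≤ m)]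
  have hcard := Finset.card_le_card hsub
  rw [Finset.card_range] at hcard
  have : (((Finset.range N).filter fun m : ℕ => x < (1 / 4 : ℝ) ^ m).card : ℝ) ≤
      1 - Real.log x := by
    refine (Nat.cast_le.2 hcard).trans ?_
    push_cast
    linarith [Nat.floor_le hlog]
  calc _ ≤ x * (1 - Real.log x) := by gcongr
    _ = gfun x := by rw [gfun, Real.negMulLog]; ring

theorem exists_truncations {A : F →L[ℂ] F} (hA : PosTr A) (h1 : trR A ≤ 1) {s : Set F}
    (hs : IsONB s) (hfin : sumG s A ≠ ∞) :
    ∃ t : ℕ → Finset s, (∀ m, ((t m).card : ℝ) ≤ 4 ^ m) ∧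
      ∀ N, ∑ m ∈ Finset.range N, (trR A - ∑ v ∈ t m, qf A v) ≤ (sumG s A).toReal := by
  have hsum := hA.hasSum hs
  have hx0 : ∀ v : s, 0 ≤ qf A v := fun v => qf_nonneg hA.1 _
  have hx1 : ∀ v : s, qf A v ≤ 1 := fun v => (qf_mem_Icc hA h1 (hs.1.1 v).le).2
  have hfinite : ∀ m : ℕ, {v : s | ¬ qf A v < (1 / 4 : ℝ) ^ m}.Finite := fun m =>
    (hsum.summable.tendsto_cofinite_zero.eventually_lt_const (by positivity))
  let t : ℕ → Finset s := fun m => (hfinite m).toFinset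
  have ht : ∀ m v, v ∈ t m ↔ (1 / 4 : ℝ) ^ m ≤ qf A v := by
    intro m v; simp [t]
  refine ⟨t, fun m => ?_, fun N => ?_⟩
  · have h2 : (t m).card * (1 / 4 : ℝ) ^ m ≤ 1 := by
      rw [← nsmul_eq_mul]
      refine (Finset.card_nsmul_le_sum (t m) (fun v : s => qf A v) _
        fun v hv => (ht m v).1 hv).trans ?_
      exact (sum_le_hasSum _ (fun v _ => hx0 v) hsum).trans h1
    rwa [one_div, inv_pow, ← div_eq_mul_inv, div_le_one (by positivity)] at h2
  · have hm : ∀ m ∈ Finset.range N, HasSum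
        (fun v : s => qf A v - if v ∈ t m then qf A v else 0) (trR A - ∑ v ∈ t m, qf A v) := by
      intro m _
      refine hsum.sub ?_
      have h3 := hasSum_sum_of_ne_finset_zero (L := .unconditional _) (s := t m)
        (f := fun v : s => if v ∈ t m then qf A v else 0) (fun v hv => if_neg hv)
      rwa [Finset.sum_congr rfl fun v hv => if_pos hv] at h3
    rw [sumG_toReal hA h1 hs]
    refine hasSum_le (fun v => ?_) (hasSum_sum hm) (summable_gfun hA h1 hs hfin).hasSum
    refine le_trans (le_of_eq ?_) (mul_card_filter_le_gfun (hx0 v) (hx1 v) N)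
    rw [Finset.card_filter, Nat.cast_sum, Finset.mul_sum]
    refine Finset.sum_congr rfl fun m _ => ?_
    by_cases hv : qf A v < (1 / 4 : ℝ) ^ m
    · rw [if_neg (fun h => hv.not_ge ((ht m v).1 h)), if_pos hv]; simp
    · rw [if_pos ((ht m v).2 (not_lt.1 hv)), if_neg hv]; simp

end Bounded

/-! ### A finite minimax principle -/

section Minimax

/-- If every convex combination of the functions `g j` attains a value at most `C` on `K`, and
the image of `K` is convex, then the functions are simultaneously almost bounded by `C`. -/
theorem exists_forall_lt_of_convex {V ι : Type*} [Fintype ι] {K : Set V} (hne : K.Nonempty)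
    (g : ι → V → ℝ)
    (hK : ∀ w ∈ K, ∀ w' ∈ K, ∀ a b : ℝ, 0 ≤ a → 0 ≤ b → a + b = 1 →
      ∃ z ∈ K, ∀ j, g j z = a * g j w + b * g j w')
    {C D : ℝ} (hCD : C < D)
    (h : ∀ p : ι → ℝ, (∀ j, 0 ≤ p j) → ∑ j, p j = 1 → ∃ w ∈ K, ∑ j, p j * g j w ≤ C) :
    ∃ w ∈ K, ∀ j, g j w < D := by
  let S : Set (ι → ℝ) := {y | ∃ w ∈ K, ∀ j, g j w < y j}
  have hconv : Convex ℝ S := by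
    rintro y ⟨w, hw, hy⟩ z ⟨w', hw', hz⟩ a b ha hb hab
    obtain ⟨u, hu, hgu⟩ := hK w hw w' hw' a b ha hb hab
    refine ⟨u, hu, fun j => ?_⟩
    simp only [hgu, Pi.add_apply, Pi.smul_apply, smul_eq_mul]
    rcases ha.eq_or_lt with rfl | ha'
    · have hb' : b = 1 := by linarith
      subst hb'
      simpa using hz j
    · have h1 := mul_lt_mul_of_pos_left (hy j) ha'
      have h2 := mul_le_mul_of_nonneg_left (hz j).le hb
      linarith
  have hopen : IsOpen S := by
    have : S = ⋃ w ∈ K, ⋂ j, {y : ι → ℝ | g j w < y j} := by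
      ext y; simp [S]
    rw [this]
    exact isOpen_biUnion fun w _ => isOpen_iInter_of_finite fun j =>
      isOpen_lt continuous_const (continuous_apply j)
  have hup : ∀ y ∈ S, ∀ z, (∀ j, y j ≤ z j) → z ∈ S := by
    rintro y ⟨w, hw, hy⟩ z hz
    exact ⟨w, hw, fun j => (hy j).trans_le (hz j)⟩
  by_contra hcon
  obtain ⟨f, hf⟩ := geometric_hahn_banach_open_point (x := fun _ => D) hconv hopen hcon
  obtain ⟨w₀, hw₀⟩ := hne
  have hS : (fun j => g j w₀ + 1) ∈ S := ⟨w₀, hw₀, fun j => lt_add_one _⟩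
  let q : ι → ℝ := fun j => f (Pi.single j 1)
  have hfq : ∀ y, f y = ∑ j, y j * q j := by
    intro y
    conv_lhs => rw [← Finset.univ_sum_single y]
    rw [map_sum]
    refine Finset.sum_congr rfl fun j _ => ?_
    have : (Pi.single j (y j) : ι → ℝ) = y j • Pi.single j (1 : ℝ) := by
      rw [← Pi.single_smul, smul_eq_mul, mul_one]
    rw [this, map_smul, smul_eq_mul]
  have hq : ∀ j, q j ≤ 0 := by
    intro j
    by_contra! hj
    obtain ⟨n, hn⟩ := exists_nat_gt ((f (fun _ => D) - f (fun j => g j w₀ + 1)) / q j)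
    rw [div_lt_iff₀ hj] at hn
    have hmem := hf _ (hup _ hS ((fun j => g j w₀ + 1) + (n : ℝ) • Pi.single j 1) fun k => by
      simp only [Pi.add_apply, Pi.smul_apply, smul_eq_mul]
      refine le_add_of_nonneg_right (mul_nonneg (Nat.cast_nonneg _) ?_)
      by_cases hk : k = j
      · subst hk; simp
      · simp [hk])
    rw [map_add, map_smul, smul_eq_mul] at hmem
    linarith
  let Q := ∑ j, q j
  have hQ : Q < 0 := by
    refine lt_of_le_of_ne (Finset.sum_nonpos fun j _ => hq j) fun h0 => ?_
    have hz : ∀ j, q j = 0 := fun j =>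
      (Finset.sum_eq_zero_iff_of_nonpos fun j _ => hq j).1 h0 j (Finset.mem_univ _)
    have := hf _ hS
    simp [hfq, hz] at this
  obtain ⟨w, hw, hwC⟩ := h (fun j => q j / Q) (fun j => div_nonneg_of_nonpos (hq j) hQ.le)
    (by rw [← Finset.sum_div, div_self hQ.ne])
  have hlt := hf (fun j => g j w + (D - C)) ⟨w, hw, fun j => by linarith⟩
  simp only [hfq, add_mul, Finset.sum_add_distrib, ← Finset.mul_sum] at hlt
  have h1 : ∑ j, q j / Q * g j w = (∑ j, g j w * q j) / Q := by
    rw [Finset.sum_div]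
    exact Finset.sum_congr rfl fun j _ => by ring
  rw [h1, div_le_iff_of_neg hQ] at hwC
  change _ + (D - C) * Q < D * Q at hlt
  linarith

end Minimax

/-! ### Fractional Bessel families -/

section Weights

variable {E F : Type*}
variable [NormedAddCommGroup E] [InnerProductSpace ℂ E] [CompleteSpace E]
variable [NormedAddCommGroup F] [InnerProductSpace ℂ F] [CompleteSpace F]

/-- Finitely supported weights on vectors: a fractional family `∑ w x |x⟩⟨x| ≤ 1` whose
trace is at most `c`. -/
structure IsWeight (c : ℝ) (w : F →₀ ℝ) : Prop where
  nonneg : ∀ x, 0 ≤ w x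
  bessel : ∀ y, Finsupp.linearCombination ℝ (fun x : F => ‖(inner ℂ x y : ℂ)‖ ^ 2) w ≤ ‖y‖ ^ 2
  trace : Finsupp.linearCombination ℝ (fun x : F => ‖x‖ ^ 2) w ≤ c

theorem IsWeight.zero {c : ℝ} (hc : 0 ≤ c) : IsWeight c (0 : F →₀ ℝ) :=
  ⟨fun _ => le_rfl, fun y => by simp, by simpa using hc⟩

theorem IsWeight.convex {c : ℝ} : Convex ℝ {w : F →₀ ℝ | IsWeight c w} := by
  intro w hw w' hw' a b ha hb hab
  have aux : ∀ (g : F → ℝ) (K : ℝ), Finsupp.linearCombination ℝ g w ≤ K →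
      Finsupp.linearCombination ℝ g w' ≤ K →
      Finsupp.linearCombination ℝ g (a • w + b • w') ≤ K := by
    intro g K h h'
    rw [map_add, map_smul, map_smul, smul_eq_mul, smul_eq_mul]
    calc _ ≤ a * K + b * K := by gcongr
      _ = K := by rw [← add_mul, hab, one_mul]
  refine ⟨fun x => ?_, fun y => aux _ _ (hw.bessel y) (hw'.bessel y), aux _ _ hw.trace hw'.trace⟩
  simp only [Finsupp.add_apply, Finsupp.smul_apply, smul_eq_mul]
  have := hw.nonneg x
  have := hw'.nonneg x
  positivity

/-- The indicator weight of a finite set of vectors. -/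
def indicatorWeight {s : Set F} (t : Finset s) : F →₀ ℝ := ∑ v ∈ t, Finsupp.single (v : F) 1

theorem linearCombination_indicatorWeight {s : Set F} (t : Finset s) (g : F → ℝ) :
    Finsupp.linearCombination ℝ g (indicatorWeight t) = ∑ v ∈ t, g v := by
  simp [indicatorWeight, map_sum]

theorem isWeight_indicatorWeight {s : Set F} (hs : IsONB s) {t : Finset s} {c : ℝ}
    (hc : (t.card : ℝ) ≤ c) : IsWeight c (indicatorWeight t) := by
  refine ⟨fun x => ?_, fun y => ?_, ?_⟩
  · rw [indicatorWeight, Finsupp.finsetSum_apply]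
    refine Finset.sum_nonneg fun v _ => ?_
    rw [Finsupp.single_apply]
    split_ifs <;> norm_num
  · rw [linearCombination_indicatorWeight]
    exact hs.1.besselFam t y
  · rw [linearCombination_indicatorWeight]
    refine le_trans (le_of_eq ?_) hc
    have : ∀ v ∈ t, ‖(v : F)‖ ^ 2 = 1 := fun v _ => by
      rw [show ‖(v : F)‖ = 1 from hs.1.1 v, one_pow]
    rw [Finset.sum_congr rfl this]
    simp

variable {Φ : TraceMap E F}

/-- Finite mixtures of states. -/
theorem exists_mixture (hΦ : Φ.TNI) {ι : Type*} [Fintype ι] {ρ : ι → E →L[ℂ] E}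
    (hρ : ∀ j, ρ j ∈ states E) {p : ι → ℝ} (hp0 : ∀ j, 0 ≤ p j) (hp1 : ∑ j, p j = 1) :
    ∃ σ ∈ states E, trR (Φ.toFun σ) = ∑ j, p j * trR (Φ.toFun (ρ j)) ∧
      ∀ x, qf (Φ.toFun σ) x = ∑ j, p j * qf (Φ.toFun (ρ j)) x := by
  have hpos := fun j => posTr_of_mem_states (hρ j)
  let σ : E →L[ℂ] E := ∑ j, (p j : ℂ) • ρ j
  have hps : ∀ j ∈ Finset.univ, PosTr ((p j : ℂ) • ρ j) := fun j _ => (hpos j).smul (hp0 j)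
  have hσ : σ ∈ states E := by
    refine (posTr_sum _ hps).mem_states ?_
    rw [posAdditive_trR.map_sum _ hps]
    simp_rw [fun j => (hpos j).trR_smul (hp0 j), fun j => trR_of_mem_states (hρ j), mul_one]
    exact hp1
  have hmap : ∀ j, Φ.toFun ((p j : ℂ) • ρ j) = (p j : ℂ) • Φ.toFun (ρ j) :=
    fun j => Φ.map_smul _ _ (hpos j).isTC
  have htr : trR (Φ.toFun σ) = ∑ j, p j * trR (Φ.toFun (ρ j)) := by
    rw [(TraceMap.posAdditive_trR hΦ).map_sum _ hps]
    simp_rw [hmap, fun j => ((hpos j).map hΦ).trR_smul (hp0 j)]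
  have hqf : ∀ x, qf (Φ.toFun σ) x = ∑ j, p j * qf (Φ.toFun (ρ j)) x := fun x => by
    rw [(Φ.posAdditive_qf x).map_sum _ hps]
    simp_rw [hmap, qf_smul]
  exact ⟨σ, hσ, htr, hqf⟩

/-- Finitely many states admit common weights capturing almost all of their outputs. -/
theorem exists_weights (hΦ : Φ.TNI) {M : ℝ}
    (hM : ∀ ρ ∈ states E, gEnt (Φ.toFun ρ) ≤ ENNReal.ofReal M) {ι : Type*} [Fintype ι]
    {ρ : ι → E →L[ℂ] E} (hρ : ∀ j, ρ j ∈ states E) (N : ℕ) :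
    ∃ w : ℕ → F →₀ ℝ, (∀ m, IsWeight (4 ^ m) (w m)) ∧
      ∀ j, ∑ m ∈ Finset.range N, (trR (Φ.toFun (ρ j)) -
        Finsupp.linearCombination ℝ (qf (Φ.toFun (ρ j))) (w m)) ≤ max M 0 + 2 := by
  let K : Set (ℕ → F →₀ ℝ) := {w | ∀ m, IsWeight (4 ^ m) (w m)}
  let g : ι → (ℕ → F →₀ ℝ) → ℝ := fun j w => ∑ m ∈ Finset.range N,
    (trR (Φ.toFun (ρ j)) - Finsupp.linearCombination ℝ (qf (Φ.toFun (ρ j))) (w m))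
  have hK : ∀ w ∈ K, ∀ w' ∈ K, ∀ a b : ℝ, 0 ≤ a → 0 ≤ b → a + b = 1 →
      ∃ z ∈ K, ∀ j, g j z = a * g j w + b * g j w' := by
    intro w hw w' hw' a b ha hb hab
    refine ⟨fun m => a • w m + b • w' m, fun m => IsWeight.convex (hw m) (hw' m) ha hb hab,
      fun j => ?_⟩
    simp only [g, Finset.mul_sum, ← Finset.sum_add_distrib]
    refine Finset.sum_congr rfl fun m _ => ?_
    rw [map_add, map_smul, map_smul, smul_eq_mul, smul_eq_mul]
    linear_combination (-(trR (Φ.toFun (ρ j)))) * hab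
  have hlt12 : max M 0 + 1 < max M 0 + 2 := by linarith
  have hne : K.Nonempty := ⟨fun _ => 0, fun m => IsWeight.zero (pow_nonneg (by norm_num) m)⟩
  have key : ∀ p : ι → ℝ, (∀ j, 0 ≤ p j) → ∑ j, p j = 1 →
      ∃ w ∈ K, ∑ j, p j * g j w ≤ max M 0 + 1 := by
    intro p hp0 hp1
    obtain ⟨σ, hσ, htr, hqf⟩ := exists_mixture hΦ hρ hp0 hp1
    have hg : gEnt (Φ.toFun σ) < ENNReal.ofReal (max M 0 + 1) := by
      refine (hM σ hσ).trans_lt ((ENNReal.ofReal_lt_ofReal_iff (by positivity)).2 ?_)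
      linarith [le_max_left M 0]
    simp only [gEnt, iInf_lt_iff] at hg
    obtain ⟨s, hs, hsG⟩ := hg
    obtain ⟨t, ht, htN⟩ := exists_truncations ((posTr_of_mem_states hσ).map hΦ)
      (trR_map_le_one hΦ hσ) hs hsG.ne_top
    refine ⟨fun m => indicatorWeight (t m), fun m => isWeight_indicatorWeight hs (ht m), ?_⟩
    have hle : (sumG s (Φ.toFun σ)).toReal ≤ max M 0 + 1 :=
      ENNReal.toReal_le_of_le_ofReal (by positivity) hsG.le
    refine le_trans (le_of_eq ?_) ((htN N).trans hle)
    simp_rw [g, linearCombination_indicatorWeight, Finset.mul_sum]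
    rw [Finset.sum_comm]
    refine Finset.sum_congr rfl fun m _ => ?_
    simp_rw [mul_sub, Finset.sum_sub_distrib, ← htr, hqf, Finset.mul_sum]
    rw [Finset.sum_comm]
  obtain ⟨w, hw, hlt⟩ := exists_forall_lt_of_convex hne g hK hlt12 key
  exact ⟨w, hw, fun j => (hlt j).le⟩

end Weights

/-! ### Rounding fractional families -/

section Rounding

variable {E F : Type*}
variable [NormedAddCommGroup E] [InnerProductSpace ℂ E] [CompleteSpace E]
variable [NormedAddCommGroup F] [InnerProductSpace ℂ F] [CompleteSpace F]

/-- A positive finite-rank operator is diagonal in some finite orthonormal system. -/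
theorem exists_diagonalization {w : F →₀ ℝ} (hw : ∀ x, 0 ≤ w x) :
    ∃ (n : ℕ) (e : Fin n → F), Orthonormal ℂ e ∧
      (∀ A : F →L[ℂ] F, Finsupp.linearCombination ℝ (qf A) w =
        ∑ i, Finsupp.linearCombination ℝ (fun x : F => ‖(inner ℂ x (e i) : ℂ)‖ ^ 2) w *
          qf A (e i)) ∧
      ∑ i, Finsupp.linearCombination ℝ (fun x : F => ‖(inner ℂ x (e i) : ℂ)‖ ^ 2) w =
        Finsupp.linearCombination ℝ (fun x : F => ‖x‖ ^ 2) w := by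
  let W : Submodule ℂ F := Submodule.span ℂ (w.support : Set F)
  let T : F →L[ℂ] F := ∑ x ∈ w.support, (w x : ℂ) • rankOne x
  let TW : W →ₗ[ℂ] W := ((W.orthogonalProjectionOnto ∘L T ∘L W.subtypeL : W →L[ℂ] W) : W →ₗ[ℂ] W)
  have hTinner : ∀ x y : W, (inner ℂ x (TW y) : ℂ) = inner ℂ (x : F) (T y) := by
    intro x y
    simp [TW]
  have hTy : ∀ x y : F, (inner ℂ x (T y) : ℂ) =
      ∑ z ∈ w.support, (w z : ℂ) * ((inner ℂ z y : ℂ) * inner ℂ x z) := by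
    intro x y
    simp [T, rankOne_apply]
  have hTpos : T.IsPositive := by
    rw [← ContinuousLinearMap.nonneg_iff_isPositive]
    exact Finset.sum_nonneg fun x _ => (ContinuousLinearMap.nonneg_iff_isPositive _).2
      (isPositive_smul (isPositive_rankOne x) (hw x))
  have hsymm : TW.IsSymmetric := by
    intro x y
    rw [hTinner, ← inner_conj_symm, hTinner, inner_conj_symm]
    exact hTpos.inner_left_eq_inner_right _ _
  let e := hsymm.eigenvectorBasis rfl
  have he : Orthonormal ℂ fun i => (e i : F) := e.orthonormal.comp_linearIsometry W.subtypeₗᵢ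
  have hexp : ∀ x ∈ w.support, x = ∑ i, (inner ℂ (e i : F) x : ℂ) • (e i : F) := by
    intro x hx
    have hxW : x ∈ W := Submodule.subset_span hx
    have h := congrArg (fun z : W => (z : F)) (e.sum_repr' ⟨x, hxW⟩)
    simp only [Submodule.coe_sum, Submodule.coe_smul, Submodule.coe_inner] at h
    exact h.symm
  have hlc : ∀ g : F → ℝ, Finsupp.linearCombination ℝ g w = ∑ x ∈ w.support, w x * g x :=
    fun g => rfl
  have hoff : ∀ i j, (inner ℂ (e j : F) (T (e i)) : ℂ) = if j = i then
      ((Finsupp.linearCombination ℝ (fun x : F => ‖(inner ℂ x (e i : F) : ℂ)‖ ^ 2) w : ℝ) : ℂ)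
      else 0 := by
    intro i j
    split_ifs with hij
    · subst hij
      rw [hTy, hlc, Complex.ofReal_sum]
      refine Finset.sum_congr rfl fun z _ => ?_
      rw [← inner_conj_symm (e j : F) z, Complex.mul_conj, Complex.normSq_eq_norm_sq]
      push_cast
      rfl
    · rw [← hTinner, hsymm.apply_eigenvectorBasis, inner_smul_right, e.orthonormal.2 hij, mul_zero]
  refine ⟨_, fun i => (e i : F), he, fun A => ?_, ?_⟩
  · have hC : ((Finsupp.linearCombination ℝ (qf A) w : ℝ)) =
        (∑ x ∈ w.support, (w x : ℂ) * inner ℂ x (A x) : ℂ).re := by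
      rw [hlc, Complex.re_sum]
      refine Finset.sum_congr rfl fun x _ => ?_
      rw [Complex.re_ofReal_mul, qf]
    rw [hC]
    have h1 : ∑ x ∈ w.support, (w x : ℂ) * (inner ℂ x (A x) : ℂ) =
        ∑ i, ∑ j, (inner ℂ (e j : F) (T (e i)) : ℂ) * inner ℂ (e i : F) (A (e j)) := by
      have hx : ∀ x ∈ w.support, (w x : ℂ) * (inner ℂ x (A x) : ℂ) = ∑ i, ∑ j,
          (w x : ℂ) * ((inner ℂ x (e i : F) : ℂ) * inner ℂ (e j : F) x) *
            inner ℂ (e i : F) (A (e j)) := by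
        intro x hx
        generalize (w x : ℂ) = c
        conv_lhs => rw [hexp x hx]
        rw [map_sum, sum_inner, Finset.mul_sum]
        refine Finset.sum_congr rfl fun i _ => ?_
        rw [inner_sum, Finset.mul_sum]
        refine Finset.sum_congr rfl fun j _ => ?_
        rw [map_smul, inner_smul_left, inner_smul_right, inner_conj_symm]
        ring
      rw [Finset.sum_congr rfl hx, Finset.sum_comm]
      refine Finset.sum_congr rfl fun i _ => ?_
      rw [Finset.sum_comm]
      refine Finset.sum_congr rfl fun j _ => ?_
      rw [hTy, Finset.sum_mul]
    rw [h1, Complex.re_sum]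
    refine Finset.sum_congr rfl fun i _ => ?_
    simp only [hoff, ite_mul, zero_mul, Finset.sum_ite_eq', Finset.mem_univ, if_true]
    rw [Complex.re_ofReal_mul, qf]
  · simp only [hlc]
    rw [Finset.sum_comm]
    refine Finset.sum_congr rfl fun x hx => ?_
    rw [← Finset.mul_sum]
    congr 1
    have h := e.sum_sq_norm_inner_left ⟨x, Submodule.subset_span hx⟩
    simpa only [Submodule.coe_inner, Submodule.coe_norm] using h

/-- A fractional family of trace at most `c` can be replaced by a genuine Bessel family of
`2 c` vectors at the cost of a factor `2` in the defect. -/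
theorem IsWeight.exists_besselFam {w : F →₀ ℝ} {c : ℝ} (hw : IsWeight c w) {k : ℕ}
    (hk : 2 * c ≤ k) :
    ∃ u : Fin k → F, BesselFam Finset.univ u ∧ ∀ A : F →L[ℂ] F, PosTr A →
      trR A - ∑ i, qf A (u i) ≤ 2 * (trR A - Finsupp.linearCombination ℝ (qf A) w) := by
  obtain ⟨n, e, he, hdiag, htr⟩ := exists_diagonalization hw.nonneg
  set r : Fin n → ℝ :=
    fun i => Finsupp.linearCombination ℝ (fun x : F => ‖(inner ℂ x (e i) : ℂ)‖ ^ 2) w with hr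
  have hr0 : ∀ i, 0 ≤ r i := fun i =>
    Finset.sum_nonneg fun x _ => mul_nonneg (hw.nonneg x) (by positivity)
  have hr1 : ∀ i, r i ≤ 1 := fun i => by
    have := hw.bessel (e i)
    rwa [he.1, one_pow] at this
  let J := Finset.univ.filter fun i => 1 / 2 < r i
  have hJ : J.card ≤ k := by
    have h1 : (J.card : ℝ) * (1 / 2) ≤ c := by
      rw [← nsmul_eq_mul]
      refine (Finset.card_nsmul_le_sum J r _ fun i hi => (Finset.mem_filter.1 hi).2.le).trans ?_
      refine (Finset.sum_le_univ_sum_of_nonneg hr0).trans ?_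
      rw [htr]
      exact hw.trace
    have : (J.card : ℝ) ≤ k := by linarith
    exact_mod_cast this
  obtain ⟨f⟩ := Function.Embedding.nonempty_of_card_le (α := J) (β := Fin k) (by simpa using hJ)
  let u : Fin k → F := Function.extend f (fun i : J => e i) 0
  have hu : ∀ g : F → ℝ, g 0 = 0 → ∑ i, g (u i) = ∑ i ∈ J, g (e i) := by
    intro g hg
    rw [← Finset.sum_attach J, ← Finset.univ_eq_attach]
    symm
    refine Finset.sum_of_injOn f f.injective.injOn (fun _ _ => Finset.mem_univ _)
      (fun j _ hj => ?_) fun i _ => ?_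
    · have : ¬ ∃ a, f a = j := fun ⟨a, ha⟩ => hj ⟨a, by simp, ha⟩
      simp only [u, Function.extend_apply' _ _ _ this, Pi.zero_apply, hg]
    · simp only [u, f.injective.extend_apply]
  refine ⟨u, fun y => ?_, fun A hA => ?_⟩
  · rw [hu (fun z => ‖(inner ℂ z y : ℂ)‖ ^ 2) (by simp)]
    exact he.besselFam J y
  · rw [hu (qf A) (by simp [qf]), hdiag]
    have h1 := (he.besselFam Finset.univ).sum_qf_le hA
    have h2 : 2 * ∑ i, r i * qf A (e i) - ∑ i ∈ J, qf A (e i) ≤ ∑ i, qf A (e i) := by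
      rw [Finset.sum_filter, Finset.mul_sum, ← Finset.sum_sub_distrib]
      refine Finset.sum_le_sum fun i _ => ?_
      have hq := qf_nonneg hA.1 (e i)
      split_ifs with hi
      · nlinarith [hr1 i]
      · nlinarith [not_lt.1 hi]
    linarith

variable {Φ : TraceMap E F}

theorem exists_besselFams (hΦ : Φ.TNI) {M : ℝ}
    (hM : ∀ ρ ∈ states E, gEnt (Φ.toFun ρ) ≤ ENNReal.ofReal M) {ι : Type*} [Fintype ι]
    {ρ : ι → E →L[ℂ] E} (hρ : ∀ j, ρ j ∈ states E) (N : ℕ) :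
    ∃ u : (m : ℕ) → Fin (2 * 4 ^ m) → F, (∀ m, BesselFam Finset.univ (u m)) ∧
      ∀ j, ∑ m ∈ Finset.range N, (trR (Φ.toFun (ρ j)) -
        ∑ i, qf (Φ.toFun (ρ j)) (u m i)) ≤ 2 * (max M 0 + 2) := by
  obtain ⟨w, hw, hwN⟩ := exists_weights hΦ hM hρ N
  choose u hu huA using fun m => (hw m).exists_besselFam (k := 2 * 4 ^ m) (by push_cast; exact le_rfl)
  refine ⟨u, hu, fun j => ?_⟩
  refine le_trans ?_ (mul_le_mul_of_nonneg_left (hwN j) zero_le_two)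
  rw [Finset.mul_sum]
  exact Finset.sum_le_sum fun m _ => huA m _ ((posTr_of_mem_states (hρ j)).map hΦ)

end Rounding

/-! ### Compactness -/

section Compactness

variable {E F : Type*}
variable [NormedAddCommGroup E] [InnerProductSpace ℂ E] [CompleteSpace E]
variable [NormedAddCommGroup F] [InnerProductSpace ℂ F] [CompleteSpace F]

/-- The unit ball of a Hilbert space is weakly compact. -/
theorem exists_weak_ball.{u} (F : Type u) [NormedAddCommGroup F] [InnerProductSpace ℂ F]
    [CompleteSpace F] : ∃ (P : Type u) (_ : TopologicalSpace P) (_ : CompactSpace P) (vec : P → F),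
      (∀ p, ‖vec p‖ ≤ 1) ∧ (∀ x, ‖x‖ ≤ 1 → ∃ p, vec p = x) ∧
      ∀ y, Continuous fun p => (inner ℂ (vec p) y : ℂ) := by
  refine ⟨(WeakDual.toStrongDual ⁻¹' Metric.closedBall (0 : StrongDual ℂ F) 1 :
    Set (WeakDual ℂ F)), inferInstance,
    isCompact_iff_compactSpace.1 (WeakDual.isCompact_closedBall _ _),
    fun p => (InnerProductSpace.toDual ℂ F).symm (WeakDual.toStrongDual p.1), fun p => ?_,
    fun x hx => ?_, fun y => ?_⟩
  · rw [LinearIsometryEquiv.norm_map]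
    exact mem_closedBall_zero_iff.1 p.2
  · refine ⟨⟨WeakDual.toStrongDual.symm (InnerProductSpace.toDual ℂ F x), ?_⟩, ?_⟩
    · rw [Set.mem_preimage, LinearEquiv.apply_symm_apply, mem_closedBall_zero_iff,
        LinearIsometryEquiv.norm_map]
      exact hx
    · simp
  · simp only [InnerProductSpace.toDual_symm_apply]
    exact (WeakDual.eval_continuous y).comp continuous_subtype_val

/-- The quadratic form of a positive trace-class operator is weakly continuous on the unit ball. -/
theorem PosTr.continuous_qf {A : F →L[ℂ] F} (hA : PosTr A) {P : Type*} [TopologicalSpace P]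
    {vec : P → F} (h1 : ∀ p, ‖vec p‖ ≤ 1) (hc : ∀ y, Continuous fun p => (inner ℂ (vec p) y : ℂ)) :
    Continuous fun p => qf A (vec p) := by
  obtain ⟨B, hB, -, hqf⟩ := exists_sqrt hA.1
  have h : ∀ p, qf A (vec p) = ∑' v : stdONB F, ‖(inner ℂ (vec p) (B v) : ℂ)‖ ^ 2 := by
    intro p
    rw [hqf, ← (isONB_stdONB.hasSum_norm_inner_sq (B (vec p))).tsum_eq]
    refine tsum_congr fun v => ?_
    rw [← hB, norm_inner_symm]
  simp only [h]
  refine continuous_tsum (fun v => (hc _).norm.pow 2) (hA.hasSum isONB_stdONB).summable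
    fun v p => ?_
  rw [Real.norm_of_nonneg (by positivity), hqf]
  refine pow_le_pow_left₀ (norm_nonneg _) ((norm_inner_le_norm _ _).trans ?_) 2
  exact mul_le_of_le_one_left (norm_nonneg _) (h1 p)

theorem BesselFam.norm_le_one {ι : Type*} {t : Finset ι} {z : ι → F} (hz : BesselFam t z) {i : ι}
    (hi : i ∈ t) : ‖z i‖ ≤ 1 := by
  have h := (Finset.single_le_sum (f := fun j => ‖(inner ℂ (z j) (z i) : ℂ)‖ ^ 2)
    (fun _ _ => by positivity) hi).trans (hz (z i))
  rw [inner_self_eq_norm_sq_to_K, norm_pow, ← pow_mul] at h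
  simp only [Complex.coe_algebraMap, Complex.norm_real, norm_norm] at h
  by_contra! h1
  nlinarith [pow_lt_pow_right₀ h1 (show 2 < 2 * 2 by norm_num)]

variable {Φ : TraceMap E F}

/-- A bounded output entropy yields finite-rank approximations which are uniformly good on all
states. -/
theorem exists_universal_besselFams (hΦ : Φ.TNI) {M : ℝ}
    (hM : ∀ ρ ∈ states E, gEnt (Φ.toFun ρ) ≤ ENNReal.ofReal M) :
    ∃ u : (m : ℕ) → Fin (2 * 4 ^ m) → F, (∀ m, BesselFam Finset.univ (u m)) ∧
      ∀ ρ ∈ states E, ∀ N : ℕ, ∑ m ∈ Finset.range N, (trR (Φ.toFun ρ) -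
        ∑ i, qf (Φ.toFun ρ) (u m i)) ≤ 2 * (max M 0 + 2) := by
  obtain ⟨P, _, _, vec, h1, hsurj, hc⟩ := exists_weak_ball F
  let K : Set ((m : ℕ) → Fin (2 * 4 ^ m) → P) :=
    ⋂ (m : ℕ) (y : F), {p | ∑ i, ‖(inner ℂ (vec (p m i)) y : ℂ)‖ ^ 2 ≤ ‖y‖ ^ 2}
  have hev : ∀ (m : ℕ) (i : Fin (2 * 4 ^ m)),
      Continuous fun p : (m : ℕ) → Fin (2 * 4 ^ m) → P => p m i :=
    fun m i => (continuous_apply i).comp (continuous_apply m)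
  have hK : IsCompact K := by
    refine IsClosed.isCompact (isClosed_iInter fun m => isClosed_iInter fun y => ?_)
    exact isClosed_le (continuous_finsetSum _ fun i _ => ((hc y).comp (hev m i)).norm.pow 2)
      continuous_const
  let S : ℕ × states E → Set ((m : ℕ) → Fin (2 * 4 ^ m) → P) := fun k =>
    {p | ∑ m ∈ Finset.range k.1, (trR (Φ.toFun k.2) - ∑ i, qf (Φ.toFun k.2) (vec (p m i))) ≤
      2 * (max M 0 + 2)}
  have hS : ∀ k, IsClosed (S k) := by
    intro k
    have hA := (posTr_of_mem_states k.2.2).map hΦ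
    exact isClosed_le (continuous_finsetSum _ fun m _ => continuous_const.sub
      (continuous_finsetSum _ fun i _ => (hA.continuous_qf h1 hc).comp (hev m i)))
      continuous_const
  obtain ⟨p, hpK, hpS⟩ := hK.inter_iInter_nonempty S hS fun t => by
    obtain ⟨u, hu, huN⟩ := exists_besselFams hΦ hM (ι := t) (ρ := fun k => (k.1.2 : E →L[ℂ] E))
      (fun k => k.1.2.2) (t.sup Prod.fst)
    choose p hp using fun m i => hsurj (u m i) ((hu m).norm_le_one (Finset.mem_univ i))
    refine ⟨p, ?_, ?_⟩
    · simp only [K, Set.mem_iInter, Set.mem_ofPred_eq, hp]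
      exact hu
    · simp only [S, Set.mem_iInter, Set.mem_ofPred_eq, hp]
      intro k hk
      refine le_trans ?_ (huN ⟨k, hk⟩)
      refine Finset.sum_le_sum_of_subset_of_nonneg
        (Finset.range_mono (Finset.le_sup (f := Prod.fst) hk)) fun m _ _ => ?_
      exact sub_nonneg.2 ((hu m).sum_qf_le ((posTr_of_mem_states k.2.2).map hΦ))
  simp only [K, Set.mem_iInter, Set.mem_ofPred_eq] at hpK
  simp only [S, Set.mem_iInter, Set.mem_ofPred_eq] at hpS
  exact ⟨fun m i => vec (p m i), hpK, fun ρ hρ N => hpS (N, ⟨ρ, hρ⟩)⟩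

end Compactness

/-! ### The energy basis -/

section EnergyBasis

variable {E F : Type*}
variable [NormedAddCommGroup E] [InnerProductSpace ℂ E] [CompleteSpace E]
variable [NormedAddCommGroup F] [InnerProductSpace ℂ F] [CompleteSpace F]

theorem BesselFam.disjSum {ι κ : Type*} {e : ι → F} (he : Orthonormal ℂ e) {t : Finset ι}
    {r : Finset κ} {u : κ → F} (hu : BesselFam r u)
    (horth : ∀ i ∈ t, ∀ j ∈ r, (inner ℂ (e i) (u j) : ℂ) = 0) :
    BesselFam (t.disjSum r) (Sum.elim e u) := by
  intro y
  rw [Finset.sum_disjSum]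
  simp only [Sum.elim_inl, Sum.elim_inr]
  set p : F := ∑ i ∈ t, (inner ℂ (e i) y : ℂ) • e i with hp
  have hep : ∀ i ∈ t, (inner ℂ (e i) (y - p) : ℂ) = 0 := fun i hi => by
    rw [inner_sub_right, hp, he.inner_right_sum _ hi, sub_self]
  have hpy : (inner ℂ p (y - p) : ℂ) = 0 := by
    rw [hp, sum_inner]
    refine Finset.sum_eq_zero fun i hi => ?_
    rw [inner_smul_left, ← hp, hep i hi, mul_zero]
  have hup : ∀ j ∈ r, (inner ℂ (u j) y : ℂ) = inner ℂ (u j) (y - p) := fun j hj => by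
    rw [inner_sub_right, hp, inner_sum, Finset.sum_eq_zero, sub_zero]
    intro i hi
    rw [inner_smul_right, ← inner_conj_symm (u j), horth i hi j hj, map_zero, mul_zero]
  have hnorm : ‖y‖ ^ 2 = ∑ i ∈ t, ‖(inner ℂ (e i) y : ℂ)‖ ^ 2 + ‖y - p‖ ^ 2 := by
    have h := norm_add_sq_eq_norm_sq_add_norm_sq_of_inner_eq_zero p (y - p) hpy
    rw [add_sub_cancel] at h
    have hpp : ‖p‖ ^ 2 = ∑ i ∈ t, ‖(inner ℂ (e i) y : ℂ)‖ ^ 2 := by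
      have := he.inner_sum (fun i => (inner ℂ (e i) y : ℂ)) (fun i => (inner ℂ (e i) y : ℂ)) t
      rw [← hp, inner_self_eq_norm_sq_to_K] at this
      have h2 : (((‖p‖ ^ 2 : ℝ)) : ℂ) = ((∑ i ∈ t, ‖(inner ℂ (e i) y : ℂ)‖ ^ 2 : ℝ) : ℂ) := by
        push_cast
        rw [show ((‖p‖ : ℂ)) ^ 2 = _ from this]
        exact Finset.sum_congr rfl fun i _ => Complex.conj_mul' _
      exact_mod_cast h2
    rw [← hpp]
    nlinarith
  rw [hnorm]
  gcongr
  refine le_trans (le_of_eq (Finset.sum_congr rfl fun j hj => ?_)) (hu (y - p))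
  rw [hup j hj]

/-- A sequence listing, for every `m`, the vectors `u m i` and `d m` at positions between `4 ^ m`
and `4 ^ (m + 1)`. -/
def interleave (u : (m : ℕ) → Fin (2 * 4 ^ m) → F) (d : ℕ → F) (n : ℕ) : F :=
  if h : n - 4 ^ Nat.log 4 n < 2 * 4 ^ Nat.log 4 n then u (Nat.log 4 n) ⟨_, h⟩
  else d (Nat.log 4 n)

theorem log_four_eq {m j : ℕ} (hj : j ≤ 2 * 4 ^ m) : Nat.log 4 (4 ^ m + j) = m := by
  have : 0 < 4 ^ m := by positivity
  refine Nat.log_eq_of_pow_le_of_lt_pow (Nat.le_add_right _ _) ?_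
  rw [pow_succ]
  omega

theorem interleave_left (u : (m : ℕ) → Fin (2 * 4 ^ m) → F) (d : ℕ → F) (m : ℕ)
    (i : Fin (2 * 4 ^ m)) : interleave u d (4 ^ m + i) = u m i := by
  have hl := log_four_eq i.2.le
  unfold interleave
  have key : ∀ k, k = m → ∀ h : 4 ^ m + (i : ℕ) - 4 ^ k < 2 * 4 ^ k,
      u k ⟨4 ^ m + i - 4 ^ k, h⟩ = u m i := by
    rintro k rfl h
    congr 1
    exact Fin.ext (by simp)
  rw [dif_pos (by rw [hl]; simp), key _ hl]

theorem interleave_right (u : (m : ℕ) → Fin (2 * 4 ^ m) → F) (d : ℕ → F) (m : ℕ) :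
    interleave u d (4 ^ m + 2 * 4 ^ m) = d m := by
  have hl := log_four_eq (le_refl (2 * 4 ^ m))
  unfold interleave
  rw [dif_neg (by rw [hl]; simp), hl]

theorem summable_exp_neg_log : Summable fun n : ℕ =>
    Real.exp (-(2 * Real.log 4 * Nat.log 4 n)) := by
  have h : ∀ n : ℕ, Real.exp (-(2 * Real.log 4 * Nat.log 4 n)) ≤ 16 * (1 / ((n + 1 : ℕ) : ℝ) ^ 2) := by
    intro n
    have h1 : ((n + 1 : ℕ) : ℝ) ≤ 4 * 4 ^ Nat.log 4 n := by
      have := Nat.lt_pow_succ_log_self (b := 4) (by norm_num) n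
      rw [pow_succ'] at this
      exact_mod_cast this
    have h2 : Real.exp (-(2 * Real.log 4 * Nat.log 4 n)) = (((4 : ℝ) ^ Nat.log 4 n) ^ 2)⁻¹ := by
      rw [Real.exp_neg, ← Real.exp_log (show (0 : ℝ) < 4 by norm_num), ← Real.exp_nat_mul,
        ← Real.exp_nat_mul, Real.exp_log (by norm_num)]
      push_cast
      ring_nf
    rw [h2, inv_eq_one_div, ← mul_div_assoc, mul_one, div_le_div_iff₀ (by positivity)
      (by positivity), one_mul]
    calc ((n + 1 : ℕ) : ℝ) ^ 2 ≤ (4 * 4 ^ Nat.log 4 n) ^ 2 := by gcongr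
      _ = 16 * (4 ^ Nat.log 4 n) ^ 2 := by ring
  refine Summable.of_nonneg_of_le (fun _ => (Real.exp_pos _).le) h (Summable.mul_left _ ?_)
  exact (summable_nat_add_iff (f := fun n : ℕ => 1 / (n : ℝ) ^ 2) 1).2
    (Real.summable_one_div_nat_pow.2 one_lt_two)

open InnerProductSpace in
/-- Gram–Schmidt turns finite-rank approximations into an orthonormal basis whose
logarithmic energy is controlled by the defects of the approximations. -/
theorem exists_energy_basis [TopologicalSpace.SeparableSpace F]
    {u : (m : ℕ) → Fin (2 * 4 ^ m) → F} (hu : ∀ m, BesselFam Finset.univ (u m)) :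
    ∃ (s : Set F) (h : s → ℝ), IsONB s ∧ (∀ v, 0 ≤ h v) ∧
      (Summable fun v => Real.exp (-h v)) ∧ ∀ {A : F →L[ℂ] F}, PosTr A → ∀ {c : ℝ},
        (∀ N, ∑ m ∈ Finset.range N, (trR A - ∑ i, qf A (u m i)) ≤ c) →
        ∀ t : Finset s, ∑ v ∈ t, h v * qf A v ≤ 2 * Real.log 4 * c := by
  let z := interleave u (TopologicalSpace.denseSeq F)
  let f : {n | gramSchmidtNormed ℂ z n ≠ 0} → F := fun n => gramSchmidtNormed ℂ z n
  have hf : Orthonormal ℂ f := gramSchmidtNormed_orthonormal' z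
  let φ := Equiv.ofInjective f hf.linearIndependent.injective
  have hφ : ∀ v, f (φ.symm v) = v := Equiv.apply_ofInjective_symm _
  have hlog : 0 < Real.log 4 := Real.log_pos (by norm_num)
  refine ⟨Set.range f, fun v => 2 * Real.log 4 * Nat.log 4 (φ.symm v), ⟨?_, ?_⟩,
    fun v => by positivity, ?_, ?_⟩
  · exact hf.toSubtypeRange
  · have hspan : Submodule.span ℂ (Set.range f) = Submodule.span ℂ (Set.range z) := by
      rw [← span_gramSchmidt ℂ z, ← span_gramSchmidtNormed_range z]
      refine le_antisymm (Submodule.span_mono ?_) (Submodule.span_le.2 ?_)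
      · rintro _ ⟨n, rfl⟩
        exact ⟨n, rfl⟩
      · rintro _ ⟨n, rfl⟩
        by_cases hn : gramSchmidtNormed ℂ z n = 0
        · rw [hn]
          exact zero_mem _
        · exact Submodule.subset_span ⟨⟨n, hn⟩, rfl⟩
    rw [hspan]
    refine (TopologicalSpace.denseRange_denseSeq F).mono ?_
    rintro _ ⟨m, rfl⟩
    exact Submodule.subset_span ⟨_, interleave_right u _ m⟩
  · exact summable_exp_neg_log.comp_injective
      (Subtype.val_injective.comp φ.symm.injective)
  · intro A hA c hc t
    obtain ⟨N, hN⟩ : ∃ N, ∀ v ∈ t, Nat.log 4 (φ.symm v) ≤ N :=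
      ⟨t.sup fun v => Nat.log 4 (φ.symm v), fun v hv =>
        Finset.le_sup (f := fun v => Nat.log 4 (φ.symm v : ℕ)) hv⟩
    have hterm : ∀ m, ∑ v ∈ t with m < Nat.log 4 (φ.symm v), qf A v ≤
        trR A - ∑ i, qf A (u m i) := by
      intro m
      have horth : ∀ v ∈ t.filter fun v => m < Nat.log 4 (φ.symm v), ∀ i ∈ Finset.univ,
          (inner ℂ (v : F) (u m i) : ℂ) = 0 := by
        intro v hv i _
        have hv := (Finset.mem_filter.1 hv).2
        have hlt : 4 ^ m + (i : ℕ) < (φ.symm v : ℕ) := by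
          by_contra! hle
          have := Nat.log_mono_right (b := 4) hle
          rw [log_four_eq i.2.le] at this
          omega
        have hz : z (4 ^ m + i) = u m i := interleave_left u _ m i
        have hGS : ∀ n : ℕ, 4 ^ m + (i : ℕ) < n →
            (inner ℂ (gramSchmidtNormed ℂ z n) (u m i) : ℂ) = 0 := fun n hn => by
          rw [← hz, gramSchmidtNormed, inner_smul_left, gramSchmidt_inv_triangular ℂ z hn, mul_zero]
        rw [← hφ v]
        exact hGS _ hlt
      have := (BesselFam.disjSum hf.toSubtypeRange (hu m) horth).sum_qf_le hA
      rw [Finset.sum_disjSum] at this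
      simp only [Sum.elim_inl, Sum.elim_inr] at this
      linarith
    have hsum : ∑ v ∈ t, (Nat.log 4 (φ.symm v) : ℝ) * qf A v ≤ c := by
      refine le_trans ?_ (hc N)
      refine le_trans (le_of_eq ?_) (Finset.sum_le_sum fun m _ => hterm m)
      simp only [Finset.sum_filter]
      rw [Finset.sum_comm]
      refine Finset.sum_congr rfl fun v hv => ?_
      rw [← Finset.sum_filter, Finset.sum_const, nsmul_eq_mul]
      congr 2
      have : (Finset.range N).filter (fun m => m < Nat.log 4 (φ.symm v)) =
          Finset.range (Nat.log 4 (φ.symm v)) := by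
        ext m
        have := hN v hv
        simp only [Finset.mem_filter, Finset.mem_range]
        omega
      rw [this, Finset.card_range]
    calc _ = 2 * Real.log 4 * ∑ v ∈ t, (Nat.log 4 (φ.symm v) : ℝ) * qf A v := by
          rw [Finset.mul_sum]
          exact Finset.sum_congr rfl fun v _ => by ring
      _ ≤ _ := by gcongr

variable {Φ : TraceMap E F}

theorem exists_energy [TopologicalSpace.SeparableSpace F] (hΦ : Φ.TNI)
    (hfin : ∀ ρ ∈ states E, gEnt (Φ.toFun ρ) ≠ ∞) :
    ∃ (s : Set F) (h : s → ℝ), IsONB s ∧ (∀ v, 0 ≤ h v) ∧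
      (Summable fun v => Real.exp (-h v)) ∧ ∃ C : ℝ, 0 ≤ C ∧ ∀ (t : Finset s) (x : E),
        ∑ v ∈ t, h v * qf (Φ.toFun (rankOne x)) v ≤ C * ‖x‖ ^ 2 := by
  obtain ⟨M, hM⟩ := exists_gEnt_le hΦ hfin
  obtain ⟨u, hu, huM⟩ := exists_universal_besselFams hΦ hM
  obtain ⟨s, h, hs, h0, hexp, hE⟩ := exists_energy_basis hu
  have hlog : 0 < Real.log 4 := Real.log_pos (by norm_num)
  refine ⟨s, h, hs, h0, hexp, 2 * Real.log 4 * (2 * (max M 0 + 2)), by positivity, fun t x => ?_⟩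
  have hsmul : ∀ (r : ℝ) (y : E) (v : F),
      qf (Φ.toFun (rankOne ((r : ℂ) • y))) v = r ^ 2 * qf (Φ.toFun (rankOne y)) v := by
    intro r y v
    have : rankOne ((r : ℂ) • y) = ((r ^ 2 : ℝ) : ℂ) • rankOne y := by
      ext w
      simp only [rankOne_apply, _root_.smul_apply, inner_smul_left, smul_smul,
        Complex.conj_ofReal]
      push_cast
      ring_nf
    rw [this, Φ.map_smul _ _ (posTr_rankOne y).isTC, qf_smul]
  by_cases hx : x = 0
  · have := hsmul 0 x
    rw [Complex.ofReal_zero, zero_smul, ← hx] at this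
    rw [hx, norm_zero, Finset.sum_eq_zero fun v _ => by rw [← hx, this]; simp]
    simp
  · have hx' : ‖x‖ ≠ 0 := norm_ne_zero_iff.2 hx
    set y : E := ((‖x‖⁻¹ : ℝ) : ℂ) • x with hy
    have hy1 : ‖y‖ = 1 := by
      rw [hy, norm_smul, Complex.norm_real, norm_inv, norm_norm, inv_mul_cancel₀ hx']
    have hxy : x = (‖x‖ : ℂ) • y := by
      rw [hy, smul_smul, ← Complex.ofReal_mul, mul_inv_cancel₀ hx', Complex.ofReal_one, one_smul]
    have hst : rankOne y ∈ states E := (posTr_rankOne y).mem_states (by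
      rw [trR_rankOne, hy1, one_pow])
    have hb := hE ((posTr_rankOne y).map hΦ) (huM _ hst) t
    have heq : ∑ v ∈ t, h v * qf (Φ.toFun (rankOne x)) v =
        (∑ v ∈ t, h v * qf (Φ.toFun (rankOne y)) v) * ‖x‖ ^ 2 := by
      rw [Finset.sum_mul]
      refine Finset.sum_congr rfl fun v _ => ?_
      conv_lhs => rw [hxy]
      rw [hsmul]
      ring
    rw [heq]
    gcongr

end EnergyBasis

/-! ### The dual map -/

section Dual

variable {E F : Type*}
variable [NormedAddCommGroup E] [InnerProductSpace ℂ E] [CompleteSpace E]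
variable [NormedAddCommGroup F] [InnerProductSpace ℂ F] [CompleteSpace F]

theorem inner_sum_dual {Φ : TraceMap E F} (hΦ : Φ.TNI) {Φstar : (F →L[ℂ] F) → (E →L[ℂ] E)}
    (hdual : ∀ (ρ : E →L[ℂ] E) (B : F →L[ℂ] F), IsTC ρ →
      traceC (Φ.toFun ρ * B) = traceC (ρ * Φstar B)) {s : Set F} (h : s → ℝ) (t : Finset s)
    (x : E) : (inner ℂ x ((∑ i ∈ t, h i • Φstar (rankOne (i : F))) x) : ℂ) =
      ((∑ i ∈ t, h i * qf (Φ.toFun (rankOne x)) i : ℝ) : ℂ) := by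
  rw [_root_.sum_apply, inner_sum, Complex.ofReal_sum]
  refine Finset.sum_congr rfl fun v _ => ?_
  have hpos := ((posTr_rankOne x).map hΦ).1
  rw [_root_.smul_apply, inner_smul_right_eq_smul, inner_dual_rankOne hdual, Complex.real_smul,
    Complex.ofReal_mul, qf]
  congr 1
  exact (Complex.conj_eq_iff_re.1 (by
    rw [inner_conj_symm]; exact hpos.inner_left_eq_inner_right _ _)).symm

theorem norm_le_of_inner_nonneg_le {T : E →L[ℂ] E} {C : ℝ} (hC : 0 ≤ C)
    (hT : ∀ x, ∃ r : ℝ, 0 ≤ r ∧ r ≤ C * ‖x‖ ^ 2 ∧ (inner ℂ x (T x) : ℂ) = r) : ‖T‖ ≤ C := by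
  have hsymm : ∀ x, (inner ℂ (T x) x : ℂ) = inner ℂ x (T x) := fun x => by
    obtain ⟨r, -, -, hr⟩ := hT x
    rw [← inner_conj_symm, hr, Complex.conj_ofReal]
  have hpos : 0 ≤ T := by
    rw [ContinuousLinearMap.nonneg_iff_isPositive, ContinuousLinearMap.isPositive_iff_complex]
    intro x
    obtain ⟨r, h0, -, hr⟩ := hT x
    rw [hsymm, hr]
    exact ⟨by simp, by simpa using h0⟩
  rw [CStarAlgebra.norm_le_iff_le_algebraMap T hC hpos, ← sub_nonneg,
    ContinuousLinearMap.nonneg_iff_isPositive, ContinuousLinearMap.isPositive_iff_complex]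
  intro x
  obtain ⟨r, h0, h1, hr⟩ := hT x
  have : (inner ℂ ((algebraMap ℝ (E →L[ℂ] E) C - T) x) x : ℂ) = ((C * ‖x‖ ^ 2 - r : ℝ) : ℂ) := by
    rw [_root_.sub_apply, inner_sub_left, hsymm, hr, Algebra.algebraMap_eq_smul_one,
      _root_.smul_apply, one_apply_eq_self, inner_smul_left_eq_smul,
      inner_self_eq_norm_sq_to_K]
    simp
  rw [this]
  exact ⟨congrArg Complex.ofReal (Complex.ofReal_re _),
    (sub_nonneg.2 h1).trans_eq (Complex.ofReal_re _).symm⟩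

end Dual

/-- Theorem 1 of the paper. For a positive linear trace-non-increasing
map `Φ` with dual map `Φ*`, the following are equivalent: (i) the output entropy is
finite at every state; (ii) the output entropy is continuous and bounded on the set of
states; (iii) for some orthonormal basis `{|i⟩}` of the output space, the classical
entropy of the diagonal of `Φ(ρ)` is continuous and bounded on the set of states;
(iv) there are an orthonormal basis `{|i⟩}` of the output space and nonnegative numbers
`{hᵢ}` with `∑ᵢ hᵢ Φ*(|i⟩⟨i|)` bounded and `∑ᵢ e^{−hᵢ} < ∞`. -/
theorem statement0
    {E F : Type*}
    [NormedAddCommGroup E] [InnerProductSpace ℂ E] [CompleteSpace E]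
    [TopologicalSpace.SeparableSpace E]
    [NormedAddCommGroup F] [InnerProductSpace ℂ F] [CompleteSpace F]
    [TopologicalSpace.SeparableSpace F]
    (Φ : TraceMap E F) (hΦ : Φ.TNI)
    (Φstar : (F →L[ℂ] F) → (E →L[ℂ] E))
    (hdual : ∀ (ρ : E →L[ℂ] E) (B : F →L[ℂ] F), IsTC ρ →
      traceC (Φ.toFun ρ * B) = traceC (ρ * Φstar B)) :
    List.TFAE
      [ ∀ ρ ∈ states E, outEntropy Φ ρ ≠ ∞,
        ContOn (outEntropy Φ) (states E) ∧ BddOn (outEntropy Φ) (states E),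
        ∃ s : Set F, IsONB s ∧
          ContOn (fun ρ => clEntropy fun v : s => qf (Φ.toFun ρ) (v : F)) (states E) ∧
          BddOn (fun ρ => clEntropy fun v : s => qf (Φ.toFun ρ) (v : F)) (states E),
        ∃ (s : Set F) (h : s → ℝ), IsONB s ∧ (∀ i : s, 0 ≤ h i) ∧
          (∃ C : ℝ, ∀ t : Finset s, ‖∑ i ∈ t, h i • Φstar (rankOne (i : F))‖ ≤ C) ∧
          (∑' i : s, ENNReal.ofReal (Real.exp (-(h i)))) ≠ ∞ ] := by
  tfae_have 1 → 4 := by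
    intro hfin
    have hg : ∀ ρ ∈ states E, gEnt (Φ.toFun ρ) ≠ ∞ := fun ρ hρ => by
      rw [← qEntropy_add ((posTr_of_mem_states hρ).map hΦ) (trR_map_le_one hΦ hρ)]
      exact ENNReal.add_ne_top.2 ⟨hfin ρ hρ, ENNReal.ofReal_ne_top⟩
    obtain ⟨s, h, hs, h0, hexp, C, hC0, hC⟩ := exists_energy hΦ hg
    refine ⟨s, h, hs, h0, ⟨C, fun t => ?_⟩, ?_⟩
    · refine norm_le_of_inner_nonneg_le hC0 fun x => ?_
      rw [inner_sum_dual hΦ hdual]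
      refine ⟨_, Finset.sum_nonneg fun v _ => mul_nonneg (h0 v) ?_, hC t x, rfl⟩
      exact qf_nonneg ((posTr_rankOne x).map hΦ).1 _
    · rw [← ENNReal.ofReal_tsum_of_nonneg (fun _ => (Real.exp_pos _).le) hexp]
      exact ENNReal.ofReal_ne_top
  tfae_have 4 → 3 := by
    rintro ⟨s, h, hs, h0, ⟨C, hC⟩, hexp⟩
    refine ⟨s, hs, clEntropy_contOn_of_energy hΦ hs h0 (C := C) (fun t x => ?_) ?_⟩
    · have h1 := congrArg Complex.re (inner_sum_dual hΦ hdual h t x)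
      rw [Complex.ofReal_re] at h1
      rw [← h1]
      calc _ ≤ ‖(inner ℂ x ((∑ i ∈ t, h i • Φstar (rankOne (i : F))) x) : ℂ)‖ := Complex.re_le_norm _
        _ ≤ ‖x‖ * (C * ‖x‖) := (norm_inner_le_norm _ _).trans (by
            gcongr; exact ContinuousLinearMap.le_of_opNorm_le _ (hC t) x)
        _ = _ := by ring
    · exact (ENNReal.summable_toReal hexp).congr fun v => ENNReal.toReal_ofReal (Real.exp_pos _).le
  tfae_have 3 → 2 := by
    rintro ⟨s, hs, hcont, C, hC⟩
    exact ⟨outEntropy_contOn_of_clEntropy hΦ hs hcont, C, fun ρ hρ =>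
      (iInf₂_le s hs).trans (hC ρ hρ)⟩
  tfae_have 2 → 1 := fun h => h.1.1
  tfae_finish

end QIT
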